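/- Initiality of the term model: for every λ_CLC-structure S over a fixed signature, the interpretation is the unique morphism of λ_CLC-structures from the term model to S, where a morphism of λ_CLC-structures is a pair of cartesian preoperad functors commuting with the functors I, preserving abstraction and application, and preserving the interpretations of all function and procedure symbols. Hence the term model is initial in the category of λ_CLC-structures. -/

import Mathlib

universe u

/-- A renaming from `m` to `n` is a function `Fin m → Fin n`. -/
abbrev Ren (m n : ℕ) : Type := Fin m → Fin n

/-- The identity renaming. -/
def idRen (n : ℕ) : Ren n n := fun i => i

/-- Block sum of renamings. -/
def bsum {m₁ n₁ m₂ n₂ : ℕ} (r : Ren m₁ n₁) (r' : Ren m₂ n₂) : Ren (m₁ + m₂) (n₁ + n₂) :=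
  fun i => Fin.addCases (motive := fun _ => Fin (n₁ + n₂))
    (fun a => Fin.castAdd n₂ (r a)) (fun b => Fin.natAdd n₁ (r' b)) i

/-- The block swap `σ_{m,n} : m+n → n+m`. -/
def swapRen (m n : ℕ) : Ren (m + n) (n + m) :=
  fun i => Fin.addCases (motive := fun _ => Fin (n + m))
    (fun a => Fin.natAdd n a) (fun b => Fin.castAdd m b) i

/-- The copy renaming `Δ_n : n+n → n`, sending both copies of `i` to `i`. -/
def copyRen (n : ℕ) : Ren (n + n) n :=
  fun i => Fin.addCases (motive := fun _ => Fin n) (fun a => a) (fun b => b) i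

/-- The discard renaming `!_n : 0 → n` (the empty function). -/
def discardRen (n : ℕ) : Ren 0 n := fun i => i.elim0

/-- Cast along an equality of arities. -/
def acast {C : ℕ → Type u} {m n : ℕ} (h : m = n) : C m → C n := fun x => h ▸ x

/-- Cast along equalities of both arities. -/
def hcast {H : ℕ → ℕ → Type u} {a a' b b' : ℕ} (h₁ : a = a') (h₂ : b = b') : H a b → H a' b' :=
  fun f => h₂ ▸ h₁ ▸ f

/-- A preoperad: a family of sets `C n` with an identity `one ∈ C 1` and single
substitution `f{n₁ ⊣ g ⊢ n₂}`, satisfying unit and associativity laws. -/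
structure Preoperad where
  C : ℕ → Type
  one : C 1
  subst : ∀ (n₁ n₂ : ℕ) {m : ℕ}, C (n₁ + 1 + n₂) → C m → C (n₁ + m + n₂)
  left_unit : ∀ {m : ℕ} (g : C m), subst 0 0 one g = acast (C := C) (by omega) g
  right_unit : ∀ {n₁ n₂ : ℕ} (f : C (n₁ + 1 + n₂)), subst n₁ n₂ f one = f
  assoc : ∀ {m₁ m₂ n₁ n₂ k : ℕ} (f : C (m₁ + 1 + m₂)) (g : C (n₁ + 1 + n₂)) (h : C k),
    subst (m₁ + n₁) (n₂ + m₂) (acast (C := C) (by omega) (subst m₁ m₂ f g)) h =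
      acast (C := C) (by omega) (subst m₁ m₂ f (subst n₁ n₂ g h))

/-- Two elements `g₁ ∈ C k₁`, `g₂ ∈ C k₂` of a preoperad commute when substituting them
into the two distinguished inputs of any morphism in either order yields the same
result (in both orientations). -/
def Preoperad.Commute (P : Preoperad) {k₁ k₂ : ℕ} (g₁ : P.C k₁) (g₂ : P.C k₂) : Prop :=
  ∀ (m₁ m m₂ : ℕ) (f : P.C (m₁ + 1 + m + 1 + m₂)),
    (P.subst (m₁ + k₁ + m) m₂
        (acast (C := P.C) (by omega)
          (P.subst m₁ (m + 1 + m₂) (acast (C := P.C) (by omega) f) g₁)) g₂ =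
      acast (C := P.C) (by omega)
        (P.subst m₁ (m + k₂ + m₂)
          (acast (C := P.C) (by omega) (P.subst (m₁ + 1 + m) m₂ f g₂)) g₁)) ∧
    (P.subst (m₁ + k₂ + m) m₂
        (acast (C := P.C) (by omega)
          (P.subst m₁ (m + 1 + m₂) (acast (C := P.C) (by omega) f) g₂)) g₁ =
      acast (C := P.C) (by omega)
        (P.subst m₁ (m + k₁ + m₂)
          (acast (C := P.C) (by omega) (P.subst (m₁ + 1 + m) m₂ f g₁)) g₂))

/-- An element is central if it commutes with every element. -/
def Preoperad.Central (P : Preoperad) {k : ℕ} (g : P.C k) : Prop :=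
  ∀ {k' : ℕ} (g' : P.C k'), P.Commute g g'

/-- A `Ren`-cartesian preoperad: a preoperad equipped with reindexing `f[r]` along all
renamings, functorially, and satisfying the renaming–substitution interchange law. -/
structure RenPreoperad extends Preoperad where
  ren : ∀ {m n : ℕ}, C m → Ren m n → C n
  ren_id : ∀ {m : ℕ} (f : C m), ren f (idRen m) = f
  ren_comp : ∀ {m n k : ℕ} (f : C m) (r₁ : Ren m n) (r₂ : Ren n k),
    ren f (r₂ ∘ r₁) = ren (ren f r₁) r₂
  ren_subst : ∀ {n₁ n₂ k m₁ m₂ m : ℕ} (f : C (n₁ + 1 + n₂)) (g : C k)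
      (r₁ : Ren n₁ m₁) (r : Ren k m) (r₂ : Ren n₂ m₂),
    ren (subst n₁ n₂ f g) (bsum (bsum r₁ r) r₂) =
      subst m₁ m₂ (ren f (bsum (bsum r₁ (idRen 1)) r₂)) (ren g r)

/-- A symmetric `Ren`-cartesian preoperad: transpositions are natural with respect to
single substitution, in both orientations. -/
structure SymRenPreoperad extends RenPreoperad where
  sym_nat₁ : ∀ {m₁ m₂ n : ℕ} (f : C (m₁ + 2 + m₂)) (g : C n),
    subst m₁ (1 + m₂)
        (acast (C := C) (by omega)
          (ren f (bsum (bsum (idRen m₁) (swapRen 1 1)) (idRen m₂)))) g =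
      acast (C := C) (by omega)
        (ren (acast (C := C) (by omega) (subst (m₁ + 1) m₂ f g))
          (bsum (bsum (idRen m₁) (swapRen 1 n)) (idRen m₂)))
  sym_nat₂ : ∀ {m₁ m₂ n : ℕ} (f : C (m₁ + 2 + m₂)) (g : C n),
    subst (m₁ + 1) m₂
        (ren f ((bsum (bsum (idRen m₁) (swapRen 1 1)) (idRen m₂) :
          Ren (m₁ + (1 + 1) + m₂) (m₁ + (1 + 1) + m₂)))) g =
      acast (C := C) (by omega)
        (ren (acast (C := C) (by omega) (subst m₁ (1 + m₂) (acast (C := C) (by omega) f) g))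
          (bsum (bsum (idRen m₁) (swapRen n 1)) (idRen m₂)))

/-- A cartesian operad: a `Ren`-cartesian symmetric preoperad in which every element is
central and in which discard and copy are natural with respect to single substitution. -/
structure CartOperad extends SymRenPreoperad where
  central : ∀ {k : ℕ} (g : C k), toPreoperad.Central g
  discard_nat : ∀ {m₁ m₂ n : ℕ} (f : C (m₁ + 0 + m₂)) (g : C n),
    subst m₁ m₂
        (ren f ((bsum (bsum (idRen m₁) (discardRen 1)) (idRen m₂) :
          Ren (m₁ + 0 + m₂) (m₁ + 1 + m₂)))) g =
      ren f ((bsum (bsum (idRen m₁) (discardRen n)) (idRen m₂) :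
        Ren (m₁ + 0 + m₂) (m₁ + n + m₂)))
  copy_nat : ∀ {m₁ m₂ n : ℕ} (f : C (m₁ + 2 + m₂)) (g : C n),
    subst m₁ m₂
        (ren f ((bsum (bsum (idRen m₁) (copyRen 1)) (idRen m₂) :
          Ren (m₁ + (1 + 1) + m₂) (m₁ + 1 + m₂)))) g =
      ren (acast (C := C) (by omega)
            (subst m₁ (n + m₂) (acast (C := C) (by omega) (subst (m₁ + 1) m₂ f g)) g))
        ((bsum (bsum (idRen m₁) (copyRen n)) (idRen m₂) :
          Ren (m₁ + (n + n) + m₂) (m₁ + n + m₂)))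

/-- A cartesian preoperad functor: preserves the identity, single substitution and
reindexing. -/
structure RenPreoperadHom (P Q : RenPreoperad) where
  map : ∀ {n : ℕ}, P.C n → Q.C n
  map_one : map P.one = Q.one
  map_subst : ∀ {n₁ n₂ m : ℕ} (f : P.C (n₁ + 1 + n₂)) (g : P.C m),
    map (P.subst n₁ n₂ f g) = Q.subst n₁ n₂ (map f) (map g)
  map_ren : ∀ {m n : ℕ} (f : P.C m) (r : Ren m n), map (P.ren f r) = Q.ren (map f) r

/-- Composition of cartesian preoperad functors. -/
def RenPreoperadHom.comp {P Q R : RenPreoperad} (F : RenPreoperadHom P Q)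
    (G : RenPreoperadHom Q R) : RenPreoperadHom P R where
  map f := G.map (F.map f)
  map_one := by show G.map (F.map P.one) = _; rw [F.map_one, G.map_one]
  map_subst f g := by
    show G.map (F.map _) = _
    rw [F.map_subst, G.map_subst]
  map_ren f r := by
    show G.map (F.map _) = _
    rw [F.map_ren, G.map_ren]

/-- A Freyd operad: a cartesian operad `V` of values, a symmetric `Ren`-cartesian
preoperad `C` of computations, and a cartesian preoperad functor `I : V → C` whose image
consists of central elements (and hence forms a cartesian operad). -/
structure FreydOperad where
  V : CartOperad
  C : SymRenPreoperad
  I : RenPreoperadHom V.toRenPreoperad C.toRenPreoperad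
  I_central : ∀ {n : ℕ} (v : V.C n), C.toPreoperad.Central (I.map v)

/-- A Freyd operad functor: a pair of cartesian preoperad functors commuting with the
functors `I`. -/
structure FreydOperadHom (O₁ O₂ : FreydOperad) where
  mapV : RenPreoperadHom O₁.V.toRenPreoperad O₂.V.toRenPreoperad
  mapC : RenPreoperadHom O₁.C.toRenPreoperad O₂.C.toRenPreoperad
  square : ∀ {n : ℕ} (v : O₁.V.C n), mapC.map (O₁.I.map v) = O₂.I.map (mapV.map v)

/-- Composition of Freyd operad functors. -/
def FreydOperadHom.comp {O₁ O₂ O₃ : FreydOperad} (F : FreydOperadHom O₁ O₂)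
    (G : FreydOperadHom O₂ O₃) : FreydOperadHom O₁ O₃ where
  mapV := F.mapV.comp G.mapV
  mapC := F.mapC.comp G.mapC
  square v := by
    show G.mapC.map (F.mapC.map _) = _
    rw [F.square, G.square]; rfl

/-- A weakly closed Freyd operad: abstraction `λₙ : C(n+1) → V(n)` and application
`@ ∈ C 2` satisfying the β-law and compatibility of abstraction with substitution. -/
structure WCFreydOperad extends FreydOperad where
  abs : ∀ {n : ℕ}, C.C (n + 1) → V.C n
  app : C.C 2
  beta : ∀ {n : ℕ} (f : C.C (n + 1)),
    C.subst 0 1 app (I.map (abs f)) = acast (C := C.C) (by omega) f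
  abs_subst : ∀ {m₁ m₂ k : ℕ} (f : C.C (m₁ + 1 + (m₂ + 1))) (v : V.C k),
    abs (acast (C := C.C) (by omega) (C.subst m₁ (m₂ + 1) f (I.map v))) =
      V.subst m₁ m₂ (abs (acast (C := C.C) (by omega) f)) v

/-- A signature: function symbols and procedure symbols, each with an arity. -/
structure Sig where
  Func : Type
  fArity : Func → ℕ
  Proc : Type
  pArity : Proc → ℕ

mutual
/-- Values of λ_CLC, well formed in a context `x₁, …, xₙ` (de Bruijn presentation):
variables, function-symbol applications, and λ-abstractions. -/
inductive DVal (Sg : Sig) : ℕ → Type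
  | var {n : ℕ} (i : Fin n) : DVal Sg n
  | func {n : ℕ} (f : Sg.Func) (args : Fin (Sg.fArity f) → DVal Sg n) : DVal Sg n
  | lam {n : ℕ} (M : DCmp Sg (n + 1)) : DVal Sg n

/-- Computations of λ_CLC, well formed in a context `x₁, …, xₙ`: returned values,
sequencing `let x = M₁ in M₂`, procedure-symbol applications, and applications. -/
inductive DCmp (Sg : Sig) : ℕ → Type
  | ret {n : ℕ} (W : DVal Sg n) : DCmp Sg n
  | letin {n : ℕ} (M₁ : DCmp Sg n) (M₂ : DCmp Sg (n + 1)) : DCmp Sg n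
  | proc {n : ℕ} (p : Sg.Proc) (args : Fin (Sg.pArity p) → DVal Sg n) : DCmp Sg n
  | app {n : ℕ} (V₁ V₂ : DVal Sg n) : DCmp Sg n
end

/-- Lift a renaming under a binder. -/
def liftRen {m n : ℕ} (r : Fin m → Fin n) : Fin (m + 1) → Fin (n + 1) :=
  fun i => Fin.lastCases (Fin.last n) (fun j => (r j).castSucc) i

mutual
/-- Rename the free variables of a value. -/
def renameV {Sg : Sig} : ∀ {m n : ℕ}, DVal Sg m → (Fin m → Fin n) → DVal Sg n
  | _, _, .var i, r => .var (r i)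
  | _, _, .func f args, r => .func f (fun i => renameV (args i) r)
  | _, _, .lam M, r => .lam (renameC M (liftRen r))

/-- Rename the free variables of a computation. -/
def renameC {Sg : Sig} : ∀ {m n : ℕ}, DCmp Sg m → (Fin m → Fin n) → DCmp Sg n
  | _, _, .ret W, r => .ret (renameV W r)
  | _, _, .letin M₁ M₂, r => .letin (renameC M₁ r) (renameC M₂ (liftRen r))
  | _, _, .proc p args, r => .proc p (fun i => renameV (args i) r)
  | _, _, .app V₁ V₂, r => .app (renameV V₁ r) (renameV V₂ r)
end

/-- Lift a simultaneous substitution under a binder. -/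
def liftSub {Sg : Sig} {m n : ℕ} (σ : Fin m → DVal Sg n) : Fin (m + 1) → DVal Sg (n + 1) :=
  fun i => Fin.lastCases (.var (Fin.last n)) (fun j => renameV (σ j) Fin.castSucc) i

mutual
/-- Capture-avoiding simultaneous substitution of values for the free variables of a
value. -/
def substV {Sg : Sig} : ∀ {m n : ℕ}, DVal Sg m → (Fin m → DVal Sg n) → DVal Sg n
  | _, _, .var i, σ => σ i
  | _, _, .func f args, σ => .func f (fun i => substV (args i) σ)
  | _, _, .lam M, σ => .lam (substC M (liftSub σ))

/-- Capture-avoiding simultaneous substitution of values for the free variables of a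
computation. -/
def substC {Sg : Sig} : ∀ {m n : ℕ}, DCmp Sg m → (Fin m → DVal Sg n) → DCmp Sg n
  | _, _, .ret W, σ => .ret (substV W σ)
  | _, _, .letin M₁ M₂, σ => .letin (substC M₁ σ) (substC M₂ (liftSub σ))
  | _, _, .proc p args, σ => .proc p (fun i => substV (args i) σ)
  | _, _, .app V₁ V₂, σ => .app (substV V₁ σ) (substV V₂ σ)
end

/-- Length of the concatenation of a family of contexts with sizes `k 0, …, k (n-1)`. -/
def finSum : ∀ {n : ℕ}, (Fin n → ℕ) → ℕ
  | 0, _ => 0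
  | n + 1, k => finSum (fun i => k i.castSucc) + k (Fin.last n)

/-- The embedding of the `i`-th block into the concatenation of blocks of sizes `k`. -/
def blockInj : ∀ {n : ℕ} (k : Fin n → ℕ) (i : Fin n), Fin (k i) → Fin (finSum k)
  | n + 1, k, i =>
      Fin.lastCases (motive := fun i => Fin (k i) → Fin (finSum k))
        (fun a => Fin.natAdd (finSum fun j => k j.castSucc) a)
        (fun j a => Fin.castAdd (k (Fin.last n)) (blockInj (fun j => k j.castSucc) j a))
        i

/-- Case analysis on the concatenation of blocks of sizes `k`. -/
def finSumCases : ∀ {n : ℕ} (k : Fin n → ℕ) {α : Sort _},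
    (∀ i, Fin (k i) → α) → Fin (finSum k) → α
  | 0, _, _, _, j => j.elim0
  | n + 1, k, _, h, j =>
      Fin.addCases (fun a => finSumCases (fun i => k i.castSucc) (fun i => h i.castSucc) a)
        (fun b => h (Fin.last n) b) j

/-- Iterated (parallel) substitution, with a fixed trailing block of size `t`. -/
def Preoperad.psubAux (P : Preoperad) :
    ∀ {n : ℕ} (k : Fin n → ℕ) (t : ℕ), P.C (n + t) → (∀ i, P.C (k i)) → P.C (finSum k + t)
  | 0, _, _, f, _ => f
  | n + 1, k, t, f, g =>
      acast (C := P.C)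
        (by simp only [finSum]; omega)
        (P.psubAux (fun i => k i.castSucc) (k (Fin.last n) + t)
          (acast (C := P.C) (by omega) (P.subst n t f (g (Fin.last n))))
          (fun i => g i.castSucc))

/-- Parallel substitution of the elements `g i ∈ C (k i)` into the `n` inputs of
`f ∈ C n` (performed sequentially; when the `g i` are central the order is
irrelevant). -/
def Preoperad.psub (P : Preoperad) {n : ℕ} (k : Fin n → ℕ) (f : P.C n)
    (g : ∀ i, P.C (k i)) : P.C (finSum k) :=
  P.psubAux k 0 f g

/-- A λ_CLC-structure over a signature: a weakly closed Freyd operad together with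
interpretations of all function and procedure symbols. -/
structure CLCStructure (Sg : Sig) where
  O : WCFreydOperad
  Ff : ∀ f : Sg.Func, O.V.C (Sg.fArity f)
  Pp : ∀ p : Sg.Proc, O.C.C (Sg.pArity p)

mutual
/-- Interpretation of values in a λ_CLC-structure: a variable is the identity reindexed
along discards, function applications are parallel substitutions into the interpretation
of the symbol (followed by contraction of the shared context), and abstractions are
interpreted by the weak closure. -/
def interpV {Sg : Sig} (S : CLCStructure Sg) : ∀ {n : ℕ}, DVal Sg n → S.O.V.C n
  | n, .var i => S.O.V.ren S.O.V.one (fun _ => i)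
  | n, .func f args =>
      S.O.V.ren
        (S.O.V.toPreoperad.psub (fun _ => n) (S.Ff f) (fun i => interpV S (args i)))
        (finSumCases (fun _ => n) (fun _ a => a))
  | _, .lam M => S.O.abs (interpC S M)

/-- Interpretation of computations in a λ_CLC-structure: `return` is interpreted by `I`,
`let` by single substitution in `C` (followed by contraction of the shared context),
procedure applications like function applications, and application via the weak
closure's application element. -/
def interpC {Sg : Sig} (S : CLCStructure Sg) : ∀ {n : ℕ}, DCmp Sg n → S.O.C.C n
  | _, .ret W => S.O.I.map (interpV S W)
  | n, .letin M₁ M₂ =>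
      S.O.C.ren (S.O.C.subst n 0 (interpC S M₂) (interpC S M₁)) (copyRen n)
  | n, .proc p args =>
      S.O.C.ren
        (S.O.C.toPreoperad.psub (fun _ => n) (S.Pp p)
          (fun i => S.O.I.map (interpV S (args i))))
        (finSumCases (fun _ => n) (fun _ a => a))
  | n, .app V₁ V₂ =>
      S.O.C.ren
        (S.O.C.toPreoperad.psub (fun _ : Fin 2 => n) S.O.app
          (fun i => S.O.I.map (Fin.cases (interpV S V₁) (fun _ => interpV S V₂) i)))
        (finSumCases (fun _ : Fin 2 => n) (fun _ a => a))
end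

/-- The single substitution `[x := W]` of a value for the last variable. -/
def sub1 {Sg : Sig} {n : ℕ} (W : DVal Sg n) : Fin (n + 1) → DVal Sg n :=
  fun i => Fin.lastCases W (fun j => .var j) i

/-- Weakening inserting a fresh variable just below the last one. -/
def midWeak (n : ℕ) : Fin (n + 1) → Fin (n + 2) :=
  fun i => Fin.lastCases (Fin.last (n + 1)) (fun j => j.castSucc.castSucc) i

mutual
/-- The equational theory of λ_CLC on values: the least congruence containing the
axioms (lunit), (runit), (assoc) and (beta). -/
inductive EqV (Sg : Sig) : {n : ℕ} → DVal Sg n → DVal Sg n → Prop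
  | refl {n : ℕ} (V : DVal Sg n) : EqV Sg V V
  | symm {n : ℕ} {V₁ V₂ : DVal Sg n} : EqV Sg V₁ V₂ → EqV Sg V₂ V₁
  | trans {n : ℕ} {V₁ V₂ V₃ : DVal Sg n} : EqV Sg V₁ V₂ → EqV Sg V₂ V₃ → EqV Sg V₁ V₃
  | func {n : ℕ} (f : Sg.Func) {args args' : Fin (Sg.fArity f) → DVal Sg n} :
      (∀ i, EqV Sg (args i) (args' i)) → EqV Sg (.func f args) (.func f args')
  | lam {n : ℕ} {M M' : DCmp Sg (n + 1)} : EqC Sg M M' → EqV Sg (.lam M) (.lam M')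

/-- The equational theory of λ_CLC on computations. -/
inductive EqC (Sg : Sig) : {n : ℕ} → DCmp Sg n → DCmp Sg n → Prop
  | refl {n : ℕ} (M : DCmp Sg n) : EqC Sg M M
  | symm {n : ℕ} {M₁ M₂ : DCmp Sg n} : EqC Sg M₁ M₂ → EqC Sg M₂ M₁
  | trans {n : ℕ} {M₁ M₂ M₃ : DCmp Sg n} : EqC Sg M₁ M₂ → EqC Sg M₂ M₃ → EqC Sg M₁ M₃
  | ret {n : ℕ} {W W' : DVal Sg n} : EqV Sg W W' → EqC Sg (.ret W) (.ret W')
  | letin {n : ℕ} {M₁ M₁' : DCmp Sg n} {M₂ M₂' : DCmp Sg (n + 1)} :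
      EqC Sg M₁ M₁' → EqC Sg M₂ M₂' → EqC Sg (.letin M₁ M₂) (.letin M₁' M₂')
  | proc {n : ℕ} (p : Sg.Proc) {args args' : Fin (Sg.pArity p) → DVal Sg n} :
      (∀ i, EqV Sg (args i) (args' i)) → EqC Sg (.proc p args) (.proc p args')
  | app {n : ℕ} {V₁ V₁' V₂ V₂' : DVal Sg n} :
      EqV Sg V₁ V₁' → EqV Sg V₂ V₂' → EqC Sg (.app V₁ V₂) (.app V₁' V₂')
  /-- (lunit) `let x = return W in M ≡ M[x := W]` -/
  | lunit {n : ℕ} (W : DVal Sg n) (M : DCmp Sg (n + 1)) :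
      EqC Sg (.letin (.ret W) M) (substC M (sub1 W))
  /-- (runit) `let x = M in return x ≡ M` -/
  | runit {n : ℕ} (M : DCmp Sg n) :
      EqC Sg (.letin M (.ret (.var (Fin.last n)))) M
  /-- (assoc) `let y = (let x = M₁ in M₂) in M ≡ let x = M₁ in (let y = M₂ in M)` -/
  | assoc {n : ℕ} (M₁ : DCmp Sg n) (M₂ : DCmp Sg (n + 1)) (M : DCmp Sg (n + 1)) :
      EqC Sg (.letin (.letin M₁ M₂) M)
        (.letin M₁ (.letin M₂ (renameC M (midWeak n))))
  /-- (beta) `(λx.M) W ≡ M[x := W]` -/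
  | beta {n : ℕ} (M : DCmp Sg (n + 1)) (W : DVal Sg n) :
      EqC Sg (.app (.lam M) W) (substC M (sub1 W))
end

/-- Embedding of the left block `n₁` into `n₁ + m + n₂`. -/
def embL (n₁ m n₂ : ℕ) : Fin n₁ → Fin (n₁ + m + n₂) :=
  fun j => Fin.castAdd n₂ (Fin.castAdd m j)

/-- Embedding of the middle block `m` into `n₁ + m + n₂`. -/
def embM (n₁ m n₂ : ℕ) : Fin m → Fin (n₁ + m + n₂) :=
  fun a => Fin.castAdd n₂ (Fin.natAdd n₁ a)

/-- Embedding of the right block `n₂` into `n₁ + m + n₂`. -/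
def embR (n₁ m n₂ : ℕ) : Fin n₂ → Fin (n₁ + m + n₂) :=
  fun z => Fin.natAdd (n₁ + m) z

/-- The simultaneous substitution replacing the distinguished middle variable of
`n₁ + 1 + n₂` by `V₂` (placed in the middle block) and renaming the other variables
accordingly. -/
def midSubst {Sg : Sig} (n₁ n₂ : ℕ) {m : ℕ} (V₂ : DVal Sg m) :
    Fin (n₁ + 1 + n₂) → DVal Sg (n₁ + m + n₂) :=
  fun i =>
    Fin.addCases (motive := fun _ => DVal Sg (n₁ + m + n₂))
      (fun j : Fin (n₁ + 1) =>
        Fin.lastCases (renameV V₂ (embM n₁ m n₂)) (fun j' => .var (embL n₁ m n₂ j')) j)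
      (fun z : Fin n₂ => .var (embR n₁ m n₂ z)) i

/-- Single substitution of a value into the distinguished middle variable of a value. -/
def tsubV {Sg : Sig} (n₁ n₂ : ℕ) {m : ℕ} (V₁ : DVal Sg (n₁ + 1 + n₂)) (V₂ : DVal Sg m) :
    DVal Sg (n₁ + m + n₂) :=
  substV V₁ (midSubst n₁ n₂ V₂)

/-- Renaming sending the distinguished middle variable of `n₁ + 1 + n₂` to the last
variable of `(n₁ + m + n₂) + 1` and the remaining variables to the corresponding
blocks. -/
def midToLast (n₁ n₂ m : ℕ) : Fin (n₁ + 1 + n₂) → Fin (n₁ + m + n₂ + 1) :=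
  fun i =>
    Fin.addCases (motive := fun _ => Fin (n₁ + m + n₂ + 1))
      (fun j : Fin (n₁ + 1) =>
        Fin.lastCases (Fin.last (n₁ + m + n₂)) (fun j' => (embL n₁ m n₂ j').castSucc) j)
      (fun z : Fin n₂ => (embR n₁ m n₂ z).castSucc) i

/-- Single substitution of a computation into the distinguished middle variable of a
computation, given by sequencing: `let y = M₂ in M₁`. -/
def tletC {Sg : Sig} (n₁ n₂ : ℕ) {m : ℕ} (M₁ : DCmp Sg (n₁ + 1 + n₂)) (M₂ : DCmp Sg m) :
    DCmp Sg (n₁ + m + n₂) :=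
  .letin (renameC M₂ (embM n₁ m n₂)) (renameC M₁ (midToLast n₁ n₂ m))

/-- `S` is a term model of λ_CLC: its carriers are equivalence classes of well-formed
terms modulo provable equality, with single substitution given by value substitution
(resp. `let`-sequencing), reindexing by syntactic renaming, `I` by `return`, abstraction
by `λ`, application by the class of `x₁ x₂`, and symbol interpretations by their
canonical terms. -/
def IsTermModel {Sg : Sig} (S : CLCStructure Sg)
    (eV : ∀ n : ℕ, S.O.V.C n ≃ Quot (@EqV Sg n)) (eC : ∀ n : ℕ, S.O.C.C n ≃ Quot (@EqC Sg n)) :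
    Prop :=
  (eV 1 S.O.V.one = Quot.mk _ (.var 0)) ∧
  (eC 1 S.O.C.one = Quot.mk _ (.ret (.var 0))) ∧
  (∀ {n₁ n₂ m : ℕ} (V₁ : DVal Sg (n₁ + 1 + n₂)) (V₂ : DVal Sg m),
    eV _ (S.O.V.subst n₁ n₂ ((eV _).symm (Quot.mk _ V₁)) ((eV _).symm (Quot.mk _ V₂))) =
      Quot.mk _ (tsubV n₁ n₂ V₁ V₂)) ∧
  (∀ {n₁ n₂ m : ℕ} (M₁ : DCmp Sg (n₁ + 1 + n₂)) (M₂ : DCmp Sg m),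
    eC _ (S.O.C.subst n₁ n₂ ((eC _).symm (Quot.mk _ M₁)) ((eC _).symm (Quot.mk _ M₂))) =
      Quot.mk _ (tletC n₁ n₂ M₁ M₂)) ∧
  (∀ {m n : ℕ} (V : DVal Sg m) (r : Ren m n),
    eV _ (S.O.V.ren ((eV _).symm (Quot.mk _ V)) r) = Quot.mk _ (renameV V r)) ∧
  (∀ {m n : ℕ} (M : DCmp Sg m) (r : Ren m n),
    eC _ (S.O.C.ren ((eC _).symm (Quot.mk _ M)) r) = Quot.mk _ (renameC M r)) ∧
  (∀ {n : ℕ} (V : DVal Sg n),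
    eC _ (S.O.I.map ((eV _).symm (Quot.mk _ V))) = Quot.mk _ (.ret V)) ∧
  (∀ {n : ℕ} (M : DCmp Sg (n + 1)),
    eV _ (S.O.abs ((eC _).symm (Quot.mk _ M))) = Quot.mk _ (.lam M)) ∧
  (eC 2 S.O.app = Quot.mk _ (.app (.var 0) (.var 1))) ∧
  (∀ f : Sg.Func, eV _ (S.Ff f) = Quot.mk _ (.func f (fun i => .var i))) ∧
  (∀ p : Sg.Proc, eC _ (S.Pp p) = Quot.mk _ (.proc p (fun i => .var i)))

/-- A morphism of λ_CLC-structures: a pair of cartesian preoperad functors commuting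
with the functors `I`, preserving abstraction and application, and preserving the
interpretations of all function and procedure symbols. -/
structure CLCHom {Sg : Sig} (S₁ S₂ : CLCStructure Sg) where
  mapV : RenPreoperadHom S₁.O.V.toRenPreoperad S₂.O.V.toRenPreoperad
  mapC : RenPreoperadHom S₁.O.C.toRenPreoperad S₂.O.C.toRenPreoperad
  squareI : ∀ {n : ℕ} (v : S₁.O.V.C n), mapC.map (S₁.O.I.map v) = S₂.O.I.map (mapV.map v)
  mapAbs : ∀ {n : ℕ} (f : S₁.O.C.C (n + 1)), mapV.map (S₁.O.abs f) = S₂.O.abs (mapC.map f)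
  mapApp : mapC.map S₁.O.app = S₂.O.app
  mapFf : ∀ f : Sg.Func, mapV.map (S₁.Ff f) = S₂.Ff f
  mapPp : ∀ p : Sg.Proc, mapC.map (S₁.Pp p) = S₂.Pp p

/-! ### Values of the basic renamings -/

lemma bsum_val {m₁ n₁ m₂ n₂ : ℕ} (r : Ren m₁ n₁) (r' : Ren m₂ n₂) (i : Fin (m₁ + m₂)) :
    (bsum r r' i).val =
      if h : i.val < m₁ then (r ⟨i.val, h⟩).val else n₁ + (r' ⟨i.val - m₁, by omega⟩).val := by
  refine Fin.addCases (fun a => ?_) (fun b => ?_) i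
  · simp [bsum]
  · simp [bsum]

lemma swapRen_val (m n : ℕ) (i : Fin (m + n)) :
    (swapRen m n i).val = if i.val < m then n + i.val else i.val - m := by
  refine Fin.addCases (fun a => ?_) (fun b => ?_) i
  · simp [swapRen]
  · simp [swapRen]

lemma copyRen_val (n : ℕ) (i : Fin (n + n)) :
    (copyRen n i).val = if i.val < n then i.val else i.val - n := by
  refine Fin.addCases (fun a => ?_) (fun b => ?_) i
  · simp [copyRen]
  · simp [copyRen, -Fin.natAdd_eq_addNat]

lemma liftRen_val {m n : ℕ} (r : Fin m → Fin n) (i : Fin (m + 1)) :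
    (liftRen r i).val = if h : i.val < m then (r ⟨i.val, h⟩).val else n := by
  refine Fin.lastCases ?_ (fun a => ?_) i
  · simp [liftRen]
  · simp [liftRen]

lemma midWeak_val (n : ℕ) (i : Fin (n + 1)) :
    (midWeak n i).val = if i.val < n then i.val else n + 1 := by
  refine Fin.lastCases ?_ (fun a => ?_) i
  · simp [midWeak]
  · simp [midWeak]

lemma midToLast_val (n₁ n₂ m : ℕ) (i : Fin (n₁ + 1 + n₂)) :
    (midToLast n₁ n₂ m i).val =
      if i.val < n₁ then i.val else if i.val = n₁ then n₁ + m + n₂ else i.val - 1 + m := by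
  refine Fin.addCases (fun a => Fin.lastCases ?_ (fun b => ?_) a) (fun c => ?_) i
  · simp only [midToLast, embR, Fin.addCases_right, Fin.val_castSucc, Fin.val_natAdd]
    split_ifs <;> omega
  · simp [midToLast]
  · simp [midToLast, embL]

/-! ### Substitution as weakening followed by substitution for the last variable -/

lemma acast_eq_ren (P : RenPreoperad) {m n : ℕ} (h : m = n) (f : P.C m) :
    acast (C := P.C) h f = P.ren f (Fin.cast h) := by
  subst h
  exact (P.ren_id f).symm

lemma RenPreoperad.ren_ren (P : RenPreoperad) {m n k : ℕ} (f : P.C m) (r₁ : Ren m n)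
    (r₂ : Ren n k) : P.ren (P.ren f r₁) r₂ = P.ren f (fun i => r₂ (r₁ i)) :=
  (P.ren_comp f r₁ r₂).symm

lemma RenPreoperad.ren_eq_self (P : RenPreoperad) {m : ℕ} (f : P.C m) (r : Ren m m)
    (h : ∀ i, (r i).val = i.val) : P.ren f r = f := by
  rw [show r = idRen m from funext fun i => Fin.ext (h i), P.ren_id]

lemma RenPreoperad.ren_congr (P : RenPreoperad) {m n : ℕ} (f : P.C m) (r s : Ren m n)
    (h : ∀ i, (r i).val = (s i).val) : P.ren f r = P.ren f s := by
  rw [show r = s from funext fun i => Fin.ext (h i)]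

lemma RenPreoperad.subst_cast (P : RenPreoperad) {a b a' b' m : ℕ} (ha : a = a') (hb : b = b')
    (h : a + 1 + b = a' + 1 + b') (f : P.C (a + 1 + b)) (g : P.C m) :
    P.subst a' b' (P.ren f (Fin.cast h)) g =
      P.ren (P.subst a b f g) (Fin.cast (by omega)) := by
  subst ha hb
  rw [P.ren_eq_self f (Fin.cast h) (fun _ => rfl), P.ren_eq_self _ (Fin.cast _) (fun _ => rfl)]

/-- Substitution for the last variable, with both arguments sharing their context. -/
def RenPreoperad.bind (P : RenPreoperad) {n : ℕ} (f : P.C (n + 1)) (g : P.C n) : P.C n :=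
  P.ren (P.subst n 0 f g) (copyRen n)

lemma RenPreoperad.ren_bind (P : RenPreoperad) {m n : ℕ} (f : P.C (m + 1)) (g : P.C m)
    (r : Ren m n) :
    P.ren (P.bind f g) r = P.bind (P.ren f (liftRen r)) (P.ren g r) := by
  have h : (liftRen r : Ren (m + 1 + 0) (n + 1 + 0)) =
      bsum (bsum r (idRen 1)) (idRen 0) := by
    funext i
    apply Fin.ext
    simp only [liftRen_val, bsum_val, idRen]
    split_ifs <;> first | rfl | omega
  have e : P.subst n 0 (P.ren f (liftRen r)) (P.ren g r) =
      P.ren (P.subst m 0 f g) (bsum (bsum r r) (idRen 0)) :=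
    (congrArg (fun s : Ren (m + 1 + 0) (n + 1 + 0) => P.subst n 0 (P.ren (n := n + 1 + 0) f s)
      (P.ren g r)) h).trans (P.ren_subst f g r r (idRen 0)).symm
  unfold RenPreoperad.bind
  rw [e, P.ren_ren, P.ren_ren]
  refine P.ren_congr _ _ _ fun i => ?_
  refine Fin.addCases (m := m) (n := m) (fun a => ?_) (fun b => ?_) i
  · refine Eq.trans ?_ (copyRen_val n _).symm
    have : a.val < m + m := by omega
    simp [copyRen, bsum_val, this]
  · refine Eq.trans ?_ (copyRen_val n _).symm
    simp [copyRen, bsum_val, -Fin.natAdd_eq_addNat]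

lemma SymRenPreoperad.subst_swap (P : SymRenPreoperad) {n₁ n₂ m : ℕ}
    (f : P.C (n₁ + 1 + (n₂ + 1))) (g : P.C m) :
    ∃ (r : Ren (n₁ + 1 + (n₂ + 1)) (n₁ + 1 + 1 + n₂))
      (s : Ren (n₁ + 1 + m + n₂) (n₁ + m + (n₂ + 1))),
      (∀ i, (r i).val = if i.val = n₁ then n₁ + 1 else if i.val = n₁ + 1 then n₁ else i.val) ∧
      (∀ i, (s i).val = if i.val < n₁ then i.val else if i.val = n₁ then n₁ + m
        else if i.val < n₁ + 1 + m then i.val - 1 else i.val) ∧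
      P.subst n₁ (n₂ + 1) f g = P.ren (P.subst (n₁ + 1) n₂ (P.ren f r) g) s := by
  let r : Ren (n₁ + 1 + (n₂ + 1)) (n₁ + 1 + 1 + n₂) := fun i =>
    ⟨if i.val = n₁ then n₁ + 1 else if i.val = n₁ + 1 then n₁ else i.val, by
      have := i.isLt
      split_ifs <;> omega⟩
  have key := P.sym_nat₁ (m₁ := n₁) (m₂ := n₂) (P.ren f r) g
  simp only [acast_eq_ren, P.ren_ren] at key
  have h := P.subst_cast (a := n₁) (b := n₂ + 1) (a' := n₁) (b' := 1 + n₂) rfl (by omega)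
    (by omega) f g
  have e : P.ren f (Fin.cast (show n₁ + 1 + (n₂ + 1) = n₁ + 1 + (1 + n₂) by omega)) =
      P.ren f (fun i => Fin.cast (show n₁ + 2 + n₂ = n₁ + 1 + (1 + n₂) by omega)
        (bsum (bsum (idRen n₁) (swapRen 1 1)) (idRen n₂) (r i))) := by
    refine P.ren_congr _ _ _ fun i => ?_
    have := i.isLt
    simp only [Fin.val_cast, bsum_val, swapRen_val, idRen, r]
    split_ifs <;> omega
  rw [← e, h] at key
  refine ⟨r, fun i => Fin.cast (by omega) (bsum (bsum (idRen n₁) (swapRen 1 m)) (idRen n₂)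
    (Fin.cast (by omega) i)), fun i => rfl, fun i => ?_, ?_⟩
  · have := i.isLt
    simp only [Fin.val_cast, bsum_val, swapRen_val, idRen]
    split_ifs <;> omega
  · have := congrArg (fun x => P.ren x
        (Fin.cast (show n₁ + m + (1 + n₂) = n₁ + m + (n₂ + 1) by omega))) key
    simp only [P.ren_ren] at this
    exact (P.ren_eq_self _ _ (fun _ => rfl)).symm.trans this

lemma midToLast_zero (n₁ m : ℕ) :
    (midToLast n₁ 0 m : Ren (n₁ + 1 + 0) (n₁ + m + 1 + 0)) =
      bsum (bsum (Fin.castAdd m) (idRen 1)) (idRen 0) := by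
  funext i
  apply Fin.ext
  simp only [midToLast_val, bsum_val, idRen]
  have := i.isLt
  split_ifs <;> simp <;> omega

lemma SymRenPreoperad.subst_eq_bind (P : SymRenPreoperad) {n₁ n₂ m : ℕ}
    (f : P.C (n₁ + 1 + n₂)) (g : P.C m) :
    P.subst n₁ n₂ f g = P.bind (P.ren f (midToLast n₁ n₂ m)) (P.ren g (embM n₁ m n₂)) := by
  induction n₂ generalizing n₁ with
  | zero =>
    have e : P.subst (n₁ + m) 0 (P.ren f (midToLast n₁ 0 m)) (P.ren g (embM n₁ m 0)) =
        P.ren (P.subst n₁ 0 f g) (bsum (bsum (Fin.castAdd m) (embM n₁ m 0)) (idRen 0)) :=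
      (congrArg (fun s : Ren (n₁ + 1 + 0) (n₁ + m + 1 + 0) =>
        P.subst (n₁ + m) 0 (P.ren (n := n₁ + m + 1 + 0) f s)
        (P.ren g (embM n₁ m 0))) (midToLast_zero n₁ m)).trans
        (P.ren_subst f g _ _ (idRen 0)).symm
    unfold RenPreoperad.bind
    erw [e]
    rw [P.ren_ren, P.ren_eq_self]
    intro i
    simp only [copyRen_val, bsum_val, embM, idRen, Fin.val_castAdd, Fin.val_natAdd]
    have := i.isLt
    split_ifs <;> simp <;> omega
  | succ n₂ ih =>
    obtain ⟨r, s, hr, hs, h⟩ := P.subst_swap f g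
    rw [h, ih, P.ren_bind, P.ren_ren, P.ren_ren, P.ren_ren]
    congr 1
    · refine P.ren_congr _ _ _ fun i => ?_
      have := i.isLt
      simp only [liftRen_val, midToLast_val, hr, hs]
      split_ifs <;> omega
    · refine P.ren_congr _ _ _ fun i => ?_
      have := i.isLt
      simp only [embM, hs, Fin.val_castAdd, Fin.val_natAdd]
      split_ifs <;> omega

/-! ### The `let`-calculus of a symmetric `Ren`-cartesian preoperad -/

/-- The exchange of the last two variables. -/
def swapLast (n : ℕ) : Ren (n + 2) (n + 2) := fun i =>
  ⟨if i.val = n then n + 1 else if i.val = n + 1 then n else i.val, by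
    have := i.isLt
    split_ifs <;> omega⟩

/-- The contraction of the last two variables. -/
def mergeLast (n : ℕ) : Ren (n + 2) (n + 1) := fun i =>
  ⟨if i.val = n + 1 then n else i.val, by
    have := i.isLt
    split_ifs <;> omega⟩

lemma swapLast_val (n : ℕ) (i : Fin (n + 2)) :
    (swapLast n i).val = if i.val = n then n + 1 else if i.val = n + 1 then n else i.val := rfl

lemma mergeLast_val (n : ℕ) (i : Fin (n + 2)) :
    (mergeLast n i).val = if i.val = n + 1 then n else i.val := rfl

/-- The `i`-th variable. -/
def RenPreoperad.var (P : RenPreoperad) {n : ℕ} (i : Fin n) : P.C n := P.ren P.one fun _ => i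

lemma RenPreoperad.ren_var (P : RenPreoperad) {m n : ℕ} (i : Fin m) (r : Ren m n) :
    P.ren (P.var i) r = P.var (r i) := P.ren_ren _ _ _

lemma RenPreoperadHom.map_bind {P Q : RenPreoperad} (F : RenPreoperadHom P Q) {n : ℕ}
    (f : P.C (n + 1)) (g : P.C n) : F.map (P.bind f g) = Q.bind (F.map f) (F.map g) := by
  unfold RenPreoperad.bind
  rw [F.map_ren, F.map_subst]

lemma RenPreoperadHom.map_var {P Q : RenPreoperad} (F : RenPreoperadHom P Q) {n : ℕ}
    (i : Fin n) : F.map (P.var i) = Q.var i := by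
  unfold RenPreoperad.var
  rw [F.map_ren, F.map_one]

namespace SymRenPreoperad

variable (P : SymRenPreoperad)

/-- Two closed forms `bind (ren f r) (ren g s)` agree when the renamings agree. -/
lemma bind_congr {a b n : ℕ} (f : P.C a) (g : P.C b) (r r' : Ren a (n + 1)) (s s' : Ren b n)
    (hr : ∀ i, (r i).val = (r' i).val) (hs : ∀ i, (s i).val = (s' i).val) :
    P.bind (P.ren f r) (P.ren g s) = P.bind (P.ren f r') (P.ren g s') := by
  rw [P.ren_congr f r r' hr, P.ren_congr g s s' hs]

lemma bind_var_last {n : ℕ} (g : P.C n) : P.bind (P.var (Fin.last n)) g = g := by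
  have h := P.subst_eq_bind (n₁ := 0) (n₂ := 0) P.one g
  rw [P.left_unit, acast_eq_ren] at h
  have h' := congrArg (fun x => P.ren x (Fin.cast (show 0 + n + 0 = n by omega))) h
  simp only [P.ren_bind, P.ren_ren] at h'
  refine Eq.trans ?_ (h'.symm.trans (P.ren_eq_self g _ (fun _ => rfl)))
  rw [RenPreoperad.var]
  nth_rw 1 [← P.ren_eq_self g (fun i => i) (fun _ => rfl)]
  refine P.bind_congr _ _ _ _ _ _ (fun i => ?_) (fun i => ?_)
  · have := i.isLt
    simp only [liftRen_val, midToLast_val, Fin.val_last, Fin.val_cast]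
    split_ifs <;> omega
  · simp [embM]

lemma bind_var {n : ℕ} (f : P.C (n + 1)) (i : Fin n) :
    P.bind f (P.var i) = P.ren f (fun j => Fin.lastCases i (fun k => k) j) := by
  have h := P.subst_eq_bind (n₁ := n) (n₂ := 0) f P.one
  rw [P.right_unit] at h
  have h' := congrArg (fun x => P.ren x
    (fun j : Fin (n + 1) => (Fin.lastCases i (fun k => k) j : Fin n))) h
  have e : P.ren f (fun j : Fin (n + 1) => (Fin.lastCases i (fun k => k) j : Fin n)) =
    P.ren (P.bind (P.ren f (midToLast n 0 1)) (P.ren P.one (embM n 1 0))) 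
      (fun j : Fin (n + 1) => (Fin.lastCases i (fun k => k) j : Fin n)) := h'
  rw [e, P.ren_bind, P.ren_ren, P.ren_ren, RenPreoperad.var]
  nth_rw 1 [← P.ren_eq_self f (fun i => i) (fun _ => rfl)]
  refine P.bind_congr _ _ _ _ _ _ (fun j => ?_) (fun j => ?_)
  · refine Fin.lastCases ?_ (fun k => ?_) j
    · simp [liftRen_val, midToLast_val]
    · have : (midToLast n 0 1 k.castSucc) = k.castSucc.castSucc := by
        apply Fin.ext
        simp [midToLast_val]
      rw [this]
      simp [liftRen]
  · have : embM n 1 0 j = Fin.last n := by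
      apply Fin.ext
      simp [embM]
    rw [this]
    simp

lemma bind_bind {n : ℕ} (f g : P.C (n + 1)) (h : P.C n) :
    P.bind f (P.bind g h) = P.bind (P.bind (P.ren f (midWeak n)) g) h := by
  have key := P.assoc (m₁ := n) (m₂ := 0) (n₁ := n) (n₂ := 0) f g h
  simp only [acast_eq_ren, P.subst_eq_bind, P.ren_bind, P.ren_ren] at key
  have key' := congrArg (fun x => P.ren x
    (fun i : Fin (n + n + n + (0 + 0)) =>
      (⟨if i.val < n then i.val else if i.val < n + n then i.val - n else i.val - n - n, by
        have := i.isLt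
        split_ifs <;> omega⟩ : Fin n))) key
  simp only [P.ren_bind, P.ren_ren] at key'
  refine Eq.trans ?_ (key'.symm.trans ?_)
  · congr 1
    · refine (P.ren_eq_self _ _ fun i => ?_).symm
      have := i.isLt
      obtain hi | hi | hi := lt_trichotomy i.val n <;>
      simp (disch := omega) only [liftRen_val, midToLast_val, Fin.val_cast, if_pos, if_neg,
        dif_pos, dif_neg] <;>
      omega
    · congr 1
      · refine (P.ren_eq_self _ _ fun i => ?_).symm
        have := i.isLt
        obtain hi | hi | hi := lt_trichotomy i.val n <;>
        simp (disch := omega) only [liftRen_val, midToLast_val, embM,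
           Fin.val_castAdd, Fin.val_natAdd, Fin.val_cast, if_pos, if_neg, dif_pos, dif_neg] <;>
        omega
      · refine (P.ren_eq_self _ _ fun i => ?_).symm
        have := i.isLt
        simp [embM]
  · congr 1
    · congr 1
      · refine P.ren_congr _ _ _ fun i => ?_
        have := i.isLt
        obtain hi | hi | hi := lt_trichotomy i.val n <;>
        simp (disch := omega) only [liftRen_val, midToLast_val, midWeak_val, Fin.val_cast,
          if_pos, if_neg, dif_pos, dif_neg]
      · refine (P.ren_eq_self _ _ fun i => ?_)
        have := i.isLt
        obtain hi | hi | hi := lt_trichotomy i.val n <;>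
        simp (disch := omega) only [liftRen_val, midToLast_val, embM,
           Fin.val_castAdd, Fin.val_natAdd, Fin.val_cast, if_pos, if_neg, dif_pos, dif_neg] <;>
        omega
    · refine (P.ren_eq_self _ _ fun i => ?_)
      have := i.isLt
      simp [embM]
      split_ifs <;> omega

lemma bind_comm {n : ℕ} (f : P.C (n + 2)) (v w : P.C n) (hv : P.Central v) :
    P.bind (P.bind f (P.ren w Fin.castSucc)) v =
      P.bind (P.bind (P.ren f (swapLast n)) (P.ren v Fin.castSucc)) w := by
  have key := (hv w n 0 0 f).1
  simp only [acast_eq_ren, P.subst_eq_bind, P.ren_bind, P.ren_ren] at key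
  have key' := congrArg (fun x => P.ren x
    (fun i : Fin (n + n + 0 + n + 0) =>
      (⟨if i.val < n then i.val else if i.val < n + n then i.val - n else i.val - n - n, by
        have := i.isLt
        split_ifs <;> omega⟩ : Fin n))) key
  simp only [P.ren_bind, P.ren_ren] at key'
  refine Eq.trans ?_ (key'.symm.trans ?_)
  · congr 1
    · congr 1
      · refine (P.ren_eq_self _ _ fun i => ?_).symm
        have := i.isLt
        obtain hi | hi | hi := lt_trichotomy i.val n <;>
        simp (disch := omega) only [liftRen_val, midToLast_val, Fin.val_cast, if_pos, if_neg,
          dif_pos, dif_neg] <;>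
        omega
      · refine P.ren_congr _ _ _ fun i => ?_
        have := i.isLt
        obtain hi | hi | hi := lt_trichotomy i.val n <;>
        simp (disch := omega) only [liftRen_val, midToLast_val, embM,
           Fin.val_castAdd, Fin.val_natAdd, Fin.val_cast, Fin.val_castSucc, if_pos, if_neg,
           dif_pos] <;>
        omega
    · refine (P.ren_eq_self _ _ fun i => ?_).symm
      have := i.isLt
      simp [embM]
  · congr 1
    · congr 1
      · refine P.ren_congr _ _ _ fun i => ?_
        have := i.isLt
        obtain hi | hi | hi := lt_trichotomy i.val n <;>
        simp (disch := omega) only [liftRen_val, midToLast_val, swapLast_val, Fin.val_cast,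
          if_pos, if_neg, dif_pos, dif_neg]
      · refine P.ren_congr _ _ _ fun i => ?_
        have := i.isLt
        obtain hi | hi | hi := lt_trichotomy i.val n <;>
        simp (disch := omega) only [liftRen_val, midToLast_val, embM,
           Fin.val_castAdd, Fin.val_natAdd, Fin.val_cast, Fin.val_castSucc, if_pos, if_neg,
           dif_pos] <;>
        omega
    · refine (P.ren_eq_self _ _ fun i => ?_)
      have := i.isLt
      simp [embM]
      split_ifs <;> omega

end SymRenPreoperad

namespace CartOperad

variable (P : CartOperad)

lemma bind_castSucc {n : ℕ} (f v : P.C n) : P.bind (P.ren f Fin.castSucc) v = f := by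
  have key := P.discard_nat (m₁ := n) (m₂ := 0) f v
  have key' := congrArg (fun x => P.ren x (copyRen n)) key
  refine Eq.trans ?_ (key'.trans ?_)
  · rw [RenPreoperad.bind]
    congr 2
    refine P.ren_congr _ _ _ fun i => ?_
    simp [bsum_val, idRen]
  · refine (P.ren_ren _ _ _).trans (P.ren_eq_self _ _ fun i => ?_)
    have := i.isLt
    simp (disch := omega) [bsum_val, idRen, copyRen_val]

lemma bind_mergeLast {n : ℕ} (f : P.C (n + 2)) (v : P.C n) :
    P.bind (P.ren f (mergeLast n)) v = P.bind (P.bind f (P.ren v Fin.castSucc)) v := by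
  have key := P.copy_nat (m₁ := n) (m₂ := 0) f v
  simp only [acast_eq_ren, P.subst_eq_bind, P.ren_bind, P.ren_ren] at key
  have key' := congrArg (fun x => P.ren x
    (fun i : Fin (n + n + 0) =>
      (⟨if i.val < n then i.val else i.val - n, by
        have := i.isLt
        split_ifs <;> omega⟩ : Fin n))) key
  simp only [P.ren_bind, P.ren_ren] at key'
  refine Eq.trans ?_ (key'.trans ?_)
  · congr 1
    · refine P.ren_congr _ _ _ fun i => ?_
      have := i.isLt
      obtain hi | hi | hi : i.val < n ∨ i.val = n ∨ i.val = n + 1 := by omega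
      all_goals
        simp (disch := omega) only [liftRen_val, midToLast_val, mergeLast_val, bsum_val, idRen,
          copyRen_val,
          if_pos, if_neg, dif_pos, dif_neg]
        try omega
    · refine (P.ren_eq_self _ _ fun i => ?_).symm
      have := i.isLt
      simp [embM]
  · congr 1
    · congr 1
      · refine P.ren_eq_self _ _ fun i => ?_
        have := i.isLt
        obtain hi | hi | hi : i.val < n ∨ i.val = n ∨ i.val = n + 1 := by omega
        all_goals
          simp (disch := omega) only [liftRen_val, midToLast_val, bsum_val, idRen,
            copyRen_val, Fin.val_cast, if_pos, if_neg, dif_pos, dif_neg]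
          try omega
      · refine P.ren_congr _ _ _ fun i => ?_
        have := i.isLt
        simp (disch := omega) only [liftRen_val, midToLast_val, bsum_val, idRen,
            copyRen_val, embM, Fin.val_cast, Fin.val_castSucc, Fin.val_castAdd, Fin.val_natAdd, 
            if_pos, if_neg, dif_pos, dif_neg]
        omega
    · refine (P.ren_eq_self _ _ fun i => ?_)
      have := i.isLt
      simp (disch := omega) only [bsum_val, idRen,
            copyRen_val, embM, Fin.val_cast, Fin.val_castAdd, Fin.val_natAdd, 
            if_pos, if_neg, dif_pos, dif_neg]
      omega

end CartOperad

namespace SymRenPreoperad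

/-- An element that behaves like a value: its weakenings are central, discardable and
copyable. -/
structure IsValue (P : SymRenPreoperad) {n : ℕ} (v : P.C n) : Prop where
  central : ∀ {m : ℕ} (r : Ren n m), P.Central (P.ren v r)
  discard : ∀ {m : ℕ} (r : Ren n m) (f : P.C m), P.bind (P.ren f Fin.castSucc) (P.ren v r) = f
  copy : ∀ {m : ℕ} (r : Ren n m) (f : P.C (m + 2)),
    P.bind (P.ren f (mergeLast m)) (P.ren v r) =
      P.bind (P.bind f (P.ren (P.ren v r) Fin.castSucc)) (P.ren v r)

variable {P : SymRenPreoperad}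

lemma IsValue.ren {m n : ℕ} {v : P.C m} (hv : P.IsValue v) (r : Ren m n) :
    P.IsValue (P.ren v r) where
  central s := by rw [P.ren_ren]; exact hv.central _
  discard s f := by rw [P.ren_ren]; exact hv.discard _ f
  copy s f := by rw [P.ren_ren]; exact hv.copy _ f

lemma IsValue.bind_castSucc {n : ℕ} {v : P.C n} (hv : P.IsValue v) (f : P.C n) :
    P.bind (P.ren f Fin.castSucc) v = f := by
  have h := hv.discard (idRen n) f
  rwa [P.ren_id] at h

lemma IsValue.bind_mergeLast {n : ℕ} {v : P.C n} (hv : P.IsValue v) (f : P.C (n + 2)) :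
    P.bind (P.ren f (mergeLast n)) v = P.bind (P.bind f (P.ren v Fin.castSucc)) v := by
  have h := hv.copy (idRen n) f
  rwa [P.ren_id] at h

lemma IsValue.bind_comm {n : ℕ} {v : P.C n} (hv : P.IsValue v) (f : P.C (n + 2)) (w : P.C n) :
    P.bind (P.bind f (P.ren w Fin.castSucc)) v =
      P.bind (P.bind (P.ren f (swapLast n)) (P.ren v Fin.castSucc)) w := by
  refine P.bind_comm f v w ?_
  have h : P.Central (P.ren v (idRen n)) := hv.central (idRen n)
  rwa [P.ren_id] at h

/-- Substitution of a value commutes with `bind`. -/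
lemma IsValue.bind_bind_value {n : ℕ} {v : P.C n} (hv : P.IsValue v) (f : P.C (n + 2))
    (w : P.C (n + 1)) :
    P.bind (P.bind f w) v =
      P.bind (P.bind (P.ren f (swapLast n)) (P.ren v Fin.castSucc)) (P.bind w v) := by
  rw [P.bind_bind, P.ren_bind]
  have e : P.ren (P.ren v Fin.castSucc) (midWeak n) =
      P.ren (P.ren v Fin.castSucc) Fin.castSucc := by
    rw [P.ren_ren, P.ren_ren]
    exact P.ren_congr _ _ _ fun i => by simp [midWeak_val]
  rw [e]
  have c := (hv.ren Fin.castSucc).bind_comm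
    (P.ren (P.ren (P.ren f (swapLast n)) (liftRen (midWeak n))) (swapLast (n + 1))) w
  have e2 : P.ren (P.ren (P.ren (P.ren f (swapLast n)) (liftRen (midWeak n)))
      (swapLast (n + 1))) (swapLast (n + 1)) =
      P.ren (P.ren f (swapLast n)) (liftRen (midWeak n)) := by
    rw [P.ren_ren (P.ren (P.ren f (swapLast n)) (liftRen (midWeak n)))]
    refine P.ren_eq_self _ _ fun i => ?_
    simp only [swapLast_val]
    split_ifs <;> omega
  rw [e2] at c
  rw [← c, ← hv.bind_mergeLast, P.ren_bind]
  congr 2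
  · simp only [P.ren_ren]
    refine (P.ren_eq_self _ _ fun i => ?_).symm
    have := i.isLt
    obtain hi | hi | hi : i.val < n ∨ i.val = n ∨ i.val = n + 1 := by omega
    all_goals
      simp (disch := omega) only [liftRen_val, midWeak_val, mergeLast_val, swapLast_val,
        if_pos, if_neg, dif_pos, dif_neg, ↓reduceIte]
      try omega
  · rw [P.ren_ren]
    refine (P.ren_eq_self _ _ fun i => ?_).symm
    have := i.isLt
    simp (disch := omega) only [mergeLast_val, Fin.val_castSucc, if_neg]

end SymRenPreoperad

lemma CartOperad.isValue (P : CartOperad) {n : ℕ} (v : P.C n) : P.IsValue v where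
  central _ := P.central _
  discard _ f := P.bind_castSucc f _
  copy _ f := P.bind_mergeLast f _

namespace WCFreydOperad

variable (O : WCFreydOperad)

/-- The application of the function variable `x_{n+1}` to `x_n`. -/
def appRen (n : ℕ) : Ren 2 (n + 2) := fun i =>
  ⟨if i.val = 0 then n + 1 else n, by split_ifs <;> omega⟩

lemma appRen_val (n : ℕ) (i : Fin 2) :
    (appRen n i).val = if i.val = 0 then n + 1 else n := rfl

/-- The application of a value to a fresh variable. -/
def eta {n : ℕ} (u : O.V.C n) : O.C.C (n + 1) :=
  O.C.bind (O.C.ren O.app (appRen n)) (O.I.map (O.V.ren u Fin.castSucc))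

lemma bind_castSucc {n : ℕ} (f : O.C.C n) (v : O.V.C n) :
    O.C.bind (O.C.ren f Fin.castSucc) (O.I.map v) = f := by
  have key := O.C.bind_comm (O.C.var (Fin.last (n + 1))) (O.I.map v) f (O.I_central v)
  rw [O.C.bind_var_last, O.C.ren_var] at key
  rw [key]
  have e : swapLast n (Fin.last (n + 1)) = (Fin.last n).castSucc := by
    apply Fin.ext
    simp [swapLast_val]
  rw [e, ← O.I.map_var, ← O.I.map_ren, ← O.I.map_bind, ← O.V.ren_var, O.V.bind_castSucc,
    O.I.map_var, O.C.bind_var_last]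

lemma eta_abs {n : ℕ} (f : O.C.C (n + 1)) : O.eta (O.abs f) = f := by
  have key := O.beta f
  simp only [acast_eq_ren, O.C.subst_eq_bind] at key
  have key' := congrArg (fun x => O.C.ren x (Fin.cast (show 0 + n + 1 = n + 1 by omega))) key
  simp only [O.C.ren_bind, O.C.ren_ren] at key'
  refine Eq.trans ?_ (key'.trans ?_)
  · rw [eta, O.I.map_ren]
    refine O.C.bind_congr _ _ _ _ _ _ (fun i => ?_) fun i => ?_
    · have := i.isLt
      obtain hi | hi : i.val = 0 ∨ i.val = 1 := by omega
      all_goals simp [hi, appRen_val, liftRen_val, midToLast_val]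
    · simp [embM]
  · exact O.C.ren_eq_self _ _ fun i => rfl

lemma eta_ren {m n : ℕ} (u : O.V.C m) (r : Ren m n) :
    O.eta (O.V.ren u r) = O.C.ren (O.eta u) (liftRen r) := by
  rw [eta, eta, O.C.ren_bind, ← O.I.map_ren, O.C.ren_ren, O.V.ren_ren, O.V.ren_ren]
  congr 1
  · refine O.C.ren_congr _ _ _ fun i => ?_
    have := i.isLt
    obtain hi | hi : i.val = 0 ∨ i.val = 1 := by omega
    all_goals simp [hi, appRen_val, liftRen_val]
  · congr 1
    exact O.V.ren_congr _ _ _ fun i => by simp [liftRen]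

lemma eta_bind {n : ℕ} (u : O.V.C (n + 1)) (v : O.V.C n) :
    O.eta (O.V.bind u v) =
      O.C.bind (O.C.ren (O.eta u) (swapLast n)) (O.I.map (O.V.ren v Fin.castSucc)) := by
  rw [eta, O.V.ren_bind, O.I.map_bind, O.C.bind_bind, eta, O.C.ren_bind, ← O.I.map_ren,
    O.C.ren_ren, O.C.ren_ren, O.V.ren_ren]
  congr 2
  · refine O.C.ren_congr _ _ _ fun i => ?_
    have := i.isLt
    obtain hi | hi : i.val = 0 ∨ i.val = 1 := by omega
    all_goals simp [hi, appRen_val, liftRen_val, midWeak_val, swapLast_val]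
  · congr 1
    refine O.V.ren_congr _ _ _ fun i => ?_
    have := i.isLt
    obtain hi | hi : i.val < n ∨ i.val = n := by omega
    all_goals
      simp only [liftRen_val, swapLast_val, Fin.val_castSucc]
      split_ifs <;> omega

lemma abs_cast {a b : ℕ} (h : a = b) (f : O.C.C (a + 1)) :
    O.abs (O.C.ren f (Fin.cast (by omega : a + 1 = b + 1))) = O.V.ren (O.abs f) (Fin.cast h) := by
  subst h
  exact (congrArg O.abs (O.C.ren_eq_self f _ fun _ => rfl)).trans
    (O.V.ren_eq_self (O.abs f) _ fun _ => rfl).symm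

lemma abs_eta {n : ℕ} (u : O.V.C n) :
    O.abs (O.eta u) = O.V.bind (O.V.ren (O.abs O.app) fun _ => Fin.last n) u := by
  have key := O.abs_subst (m₁ := 0) (m₂ := 0) O.app u
  simp only [acast_eq_ren, O.C.subst_eq_bind, O.V.subst_eq_bind] at key
  have key' := congrArg (fun x => O.V.ren x (Fin.cast (show 0 + n + 0 = n by omega))) key
  simp only [← O.abs_cast (show 0 + n + 0 = n by omega), O.V.ren_bind, O.C.ren_bind,
    O.C.ren_ren, O.V.ren_ren] at key'
  refine Eq.trans ?_ (key'.trans ?_)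
  · rw [eta, O.I.map_ren]
    congr 1
    refine O.C.bind_congr _ _ _ _ _ _ (fun i => ?_) fun i => ?_
    · have := i.isLt
      obtain hi | hi : i.val = 0 ∨ i.val = 1 := by omega
      all_goals simp [hi, appRen_val, liftRen_val, midToLast_val]
    · simp [embM]
  · congr 1
    · have e : O.C.ren O.app (Fin.cast (show 2 = 0 + 1 + 0 + 1 by omega)) = O.app :=
        O.C.ren_eq_self _ _ fun _ => rfl
      refine Eq.trans (O.V.ren_congr _ _ (fun _ => Fin.last n) fun i => ?_) ?_
      · have := i.isLt
        simp (disch := omega) only [liftRen_val, midToLast_val, Fin.val_cast, if_pos, if_neg,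
          dif_neg, Fin.val_last]
      · exact congrArg (fun x => O.V.ren (O.abs x) fun _ => Fin.last n) e
    · exact O.V.ren_eq_self _ _ fun i => by simp [embM]

/-- Abstraction commutes with renaming. -/
lemma abs_ren {m n : ℕ} (f : O.C.C (m + 1)) (r : Ren m n) :
    O.abs (O.C.ren f (liftRen r)) = O.V.ren (O.abs f) r := by
  nth_rw 1 [← O.eta_abs f]
  rw [← eta_ren, abs_eta]
  nth_rw 2 [← O.eta_abs f]
  rw [abs_eta, O.V.ren_bind, O.V.ren_ren]
  congr 1
  exact O.V.ren_congr _ _ _ fun i => by simp [liftRen_val]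

/-- Abstraction commutes with substitution of values. -/
lemma abs_bind {n : ℕ} (f : O.C.C (n + 2)) (v : O.V.C n) :
    O.abs (O.C.bind (O.C.ren f (swapLast n)) (O.I.map (O.V.ren v Fin.castSucc))) =
      O.V.bind (O.abs f) v := by
  nth_rw 1 [← O.eta_abs f]
  rw [← eta_bind, abs_eta]
  nth_rw 2 [← O.eta_abs f]
  rw [abs_eta, O.V.bind_bind, O.V.ren_ren]
  congr 2
  exact O.V.ren_congr _ _ _ fun i => by simp [midWeak_val]

lemma bind_mergeLast {n : ℕ} (f : O.C.C (n + 2)) (v : O.V.C n) :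
    O.C.bind (O.C.ren f (mergeLast n)) (O.I.map v) =
      O.C.bind (O.C.bind f (O.C.ren (O.I.map v) Fin.castSucc)) (O.I.map v) := by
  have key := congrArg O.eta
    (O.V.bind_mergeLast (O.abs (O.C.ren f (Fin.castSucc : Ren (n + 2) (n + 3)))) v)
  rw [eta_bind, eta_bind, eta_bind, eta_ren, eta_abs] at key
  have l : ∀ g : O.C.C (n + 1),
      O.C.bind (O.C.ren (O.C.ren g Fin.castSucc) (swapLast n))
        (O.I.map (O.V.ren v Fin.castSucc)) =
      O.C.ren (O.C.bind g (O.I.map v)) Fin.castSucc := by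
    intro g
    rw [O.C.ren_bind, O.C.ren_ren, O.I.map_ren]
    congr 1
    refine O.C.ren_congr _ _ _ fun i => ?_
    have := i.isLt
    simp only [swapLast_val, liftRen_val, Fin.val_castSucc]
    split_ifs <;> omega
  have e₁ : O.C.ren (O.C.ren f (Fin.castSucc : Ren (n + 2) (n + 3))) (liftRen (mergeLast n)) =
      O.C.ren (O.C.ren f (mergeLast n)) Fin.castSucc := by
    rw [O.C.ren_ren, O.C.ren_ren]
    refine O.C.ren_congr _ _ _ fun i => ?_
    simp [liftRen_val]
  have e₂ : O.C.bind (O.C.ren (O.C.ren f (Fin.castSucc : Ren (n + 2) (n + 3)))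
      (swapLast (n + 1))) (O.I.map (O.V.ren (O.V.ren v Fin.castSucc) Fin.castSucc)) =
      O.C.ren (O.C.bind f (O.C.ren (O.I.map v) Fin.castSucc)) Fin.castSucc := by
    rw [O.C.ren_bind, O.C.ren_ren, O.I.map_ren, O.I.map_ren]
    congr 1
    refine O.C.ren_congr _ _ _ fun i => ?_
    have := i.isLt
    simp only [swapLast_val, liftRen_val, Fin.val_castSucc]
    split_ifs <;> omega
  rw [e₁, e₂, l, l] at key
  have key' := congrArg (fun x => O.C.bind x (O.I.map v)) key
  simpa only [bind_castSucc] using key'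

lemma isValue_map {n : ℕ} (v : O.V.C n) : O.C.IsValue (O.I.map v) where
  central r := by rw [← O.I.map_ren]; exact O.I_central _
  discard r f := by rw [← O.I.map_ren]; exact O.bind_castSucc f _
  copy r f := by rw [← O.I.map_ren]; exact O.bind_mergeLast f _

end WCFreydOperad

/-- Iterated `bind`: the last `m` variables of `f` are bound to the elements `a i`, starting
from the last one. -/
def RenPreoperad.mbind (P : RenPreoperad) {N : ℕ} :
    ∀ {m : ℕ}, P.C (N + m) → (Fin m → P.C N) → P.C N
  | 0, f, _ => f
  | m + 1, f, a =>
      P.mbind (m := m) (P.bind f (P.ren (a (Fin.last m)) (Fin.castAdd m)))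
        (fun i => a i.castSucc)

lemma addCases_val {m n N : ℕ} (l : Fin m → Fin N) (r : Fin n → Fin N) (i : Fin (m + n)) :
    (Fin.addCases l r i : Fin N).val =
      if h : i.val < m then (l ⟨i.val, h⟩).val else (r ⟨i.val - m, by omega⟩).val := by
  refine Fin.addCases (fun a => ?_) (fun b => ?_) i
  · simp
  · simp

lemma SymRenPreoperad.ren_psubAux (P : SymRenPreoperad) {N m : ℕ} : ∀ (k : Fin m → ℕ) (t : ℕ)
    (f : P.C (m + t)) (g : ∀ i, P.C (k i)) (ρ : ∀ i, Fin (k i) → Fin N) (τ : Fin t → Fin N),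
    P.ren (P.psubAux k t f g) (Fin.addCases (finSumCases k ρ) τ) =
      P.mbind (P.ren f (Fin.addCases (Fin.natAdd N) fun z => Fin.castAdd m (τ z)))
        fun i => P.ren (g i) (ρ i) := by
  induction m with
  | zero =>
    intro k t f g ρ τ
    refine P.ren_congr _ _ _ fun i => ?_
    refine Fin.addCases (fun a => a.elim0) (fun b => ?_) i
    exact (congrArg Fin.val (Fin.addCases_right (m := 0) (n := t) b)).trans
      (congrArg Fin.val (Fin.addCases_right (m := 0) (n := t) b)).symm
  | succ m ih =>
    intro k t f g ρ τ
    rw [Preoperad.psubAux, acast_eq_ren, P.ren_ren, RenPreoperad.mbind]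
    have e := ih (fun i => k i.castSucc) (k (Fin.last m) + t)
      (acast (C := P.C) (by omega) (P.subst m t f (g (Fin.last m)))) (fun i => g i.castSucc)
      (fun i => ρ i.castSucc) (Fin.addCases (ρ (Fin.last m)) τ)
    refine Eq.trans (P.ren_congr _ _ _ fun i => ?_) (e.trans ?_)
    · refine Fin.addCases (fun a => ?_) (fun b => Fin.addCases (fun c => ?_) (fun d => ?_) b) i
      · rw [Fin.addCases_left]
        exact congrArg Fin.val ((Fin.addCases_left (m := finSum k) (n := t)
          (Fin.castAdd (k (Fin.last m)) a)).trans (Fin.addCases_left a))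
      · rw [Fin.addCases_right, Fin.addCases_left]
        exact congrArg Fin.val ((Fin.addCases_left (m := finSum k) (n := t)
          (Fin.natAdd (finSum fun i => k i.castSucc) c)).trans (Fin.addCases_right c))
      · rw [Fin.addCases_right, Fin.addCases_right]
        have h : (Fin.cast (by simp only [finSum]; omega)
          (Fin.natAdd (finSum fun i => k i.castSucc) (Fin.natAdd (k (Fin.last m)) d)) :
            Fin (finSum k + t)) = Fin.natAdd (finSum k) d :=
          Fin.ext (Nat.add_assoc _ _ _).symm
        exact congrArg Fin.val ((congrArg _ h).trans (Fin.addCases_right d))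
    · congr 1
      rw [acast_eq_ren, P.subst_eq_bind, P.ren_bind, P.ren_bind]
      simp only [P.ren_ren]
      congr 1
      · refine P.ren_congr _ _ _ fun i => ?_
        have := i.isLt
        obtain hi | hi | hi := lt_trichotomy i.val m <;>
        simp (disch := omega) only [liftRen_val, midToLast_val, addCases_val, Fin.val_cast,
          Fin.val_natAdd, Fin.val_castAdd, if_pos, if_neg, dif_pos, dif_neg]
        · omega
        · refine congrArg (fun z => (τ z).val) (Fin.ext ?_)
          dsimp only
          omega
      · refine P.ren_congr _ _ _ fun i => ?_
        have : (Fin.cast (by omega) (embM m (k (Fin.last m)) t i) :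
          Fin (m + (k (Fin.last m) + t))) = Fin.natAdd m (Fin.castAdd t i) := by
          apply Fin.ext
          simp [embM]
        rw [this, Fin.addCases_right, Fin.addCases_left]

/-- Simultaneous `bind` of all the variables of `f`. -/
def RenPreoperad.mapp (P : RenPreoperad) {n k : ℕ} (f : P.C k) (a : Fin k → P.C n) : P.C n :=
  P.mbind (P.ren f (Fin.natAdd n)) a

lemma SymRenPreoperad.ren_psub (P : SymRenPreoperad) {n k : ℕ} (f : P.C k)
    (a : Fin k → P.C n) :
    P.ren (P.psub (fun _ => n) f a) (finSumCases (fun _ => n) fun _ a => a) = P.mapp f a := by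
  have h := P.ren_psubAux (fun _ : Fin k => n) 0 f a (fun _ a => a) (fun i => i.elim0)
  refine Eq.trans (P.ren_congr _ _ _ fun i => ?_) (h.trans ?_)
  · rw [addCases_val, dif_pos i.isLt]
  · rw [RenPreoperad.mapp]
    congr 1
    · refine P.ren_congr _ _ _ fun i => ?_
      exact congrArg Fin.val (Fin.addCases_left (m := k) (n := 0) i)
    · funext i
      exact P.ren_eq_self _ _ fun _ => rfl

lemma RenPreoperad.ren_mbind (P : RenPreoperad) {N N' m : ℕ} (f : P.C (N + m))
    (a : Fin m → P.C N) (r : Ren N N') :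
    P.ren (P.mbind f a) r = P.mbind (P.ren f (bsum r (idRen m))) fun i => P.ren (a i) r := by
  induction m with
  | zero =>
    refine P.ren_congr _ _ _ fun i => ?_
    simp [bsum_val]
  | succ m ih =>
    rw [mbind, ih, mbind]
    congr 1
    rw [P.ren_bind, P.ren_ren, P.ren_ren]
    congr 1
    · refine P.ren_congr _ _ _ fun i => ?_
      have := i.isLt
      obtain hi | hi | hi : i.val < N ∨ (N ≤ i.val ∧ i.val < N + m) ∨ i.val = N + m := by omega
      all_goals
        simp (disch := omega) only [liftRen_val, bsum_val, idRen, dif_pos, dif_neg]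
      omega
    · refine P.ren_congr _ _ _ fun i => ?_
      simp [bsum_val]

lemma RenPreoperad.ren_mapp (P : RenPreoperad) {n n' k : ℕ} (f : P.C k) (a : Fin k → P.C n)
    (r : Ren n n') : P.ren (P.mapp f a) r = P.mapp f fun i => P.ren (a i) r := by
  rw [mapp, P.ren_mbind, P.ren_ren, mapp]
  congr 1
  exact P.ren_congr _ _ _ fun i => by simp [bsum_val, idRen]

/-- The renaming moving the variable `N` to the last position. -/
def rotRen (N m : ℕ) : Ren (N + 1 + m) (N + m + 1) := fun i =>
  ⟨if i.val < N then i.val else if i.val = N then N + m else i.val - 1, by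
    have := i.isLt
    split_ifs <;> omega⟩

lemma rotRen_val (N m : ℕ) (i : Fin (N + 1 + m)) : (rotRen N m i).val =
    if i.val < N then i.val else if i.val = N then N + m else i.val - 1 := rfl

lemma SymRenPreoperad.IsValue.bind_mbind {P : SymRenPreoperad} {N m : ℕ} {v : P.C N}
    (hv : P.IsValue v) (f : P.C (N + 1 + m)) (a : Fin m → P.C (N + 1)) :
    P.bind (P.mbind f a) v =
      P.mbind (P.bind (P.ren f (rotRen N m)) (P.ren v (Fin.castAdd m)))
        fun i => P.bind (a i) v := by
  induction m with
  | zero =>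
    rw [RenPreoperad.mbind, RenPreoperad.mbind]
    congr 1
    · refine (P.ren_eq_self _ _ fun i => ?_).symm
      have := i.isLt
      rw [rotRen_val]
      split_ifs <;> omega
    · exact (P.ren_eq_self _ _ fun i => rfl).symm
  | succ m ih =>
    rw [RenPreoperad.mbind, ih, RenPreoperad.mbind]
    congr 1
    rw [P.ren_bind, (hv.ren _).bind_bind_value]
    simp only [P.ren_ren, P.ren_bind]
    congr 2
    · refine P.ren_congr _ _ _ fun i => ?_
      have := i.isLt
      obtain hi | hi | hi | hi : i.val < N ∨ i.val = N ∨ (N < i.val ∧ i.val < N + 1 + m) ∨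
        i.val = N + 1 + m := by omega
      all_goals
        simp (disch := omega) only [liftRen_val, swapLast_val, rotRen_val, dif_pos, dif_neg,
          if_pos, if_neg, ↓reduceIte]
      all_goals omega
    · refine P.ren_congr _ _ _ fun i => ?_
      have := i.isLt
      obtain hi | hi : i.val < N ∨ i.val = N := by omega
      all_goals
        simp (disch := omega) only [liftRen_val, rotRen_val, dif_pos, dif_neg,
          if_pos, if_neg, Fin.val_castAdd]

lemma SymRenPreoperad.IsValue.bind_mapp {P : SymRenPreoperad} {n k : ℕ} {v : P.C n}
    (hv : P.IsValue v) (f : P.C k) (a : Fin k → P.C (n + 1)) :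
    P.bind (P.mapp f a) v = P.mapp f fun i => P.bind (a i) v := by
  rw [RenPreoperad.mapp, hv.bind_mbind, P.ren_ren, RenPreoperad.mapp]
  congr 1
  refine Eq.trans ?_ ((hv.ren (Fin.castAdd k)).bind_castSucc _)
  rw [P.ren_ren]
  congr 1
  refine P.ren_congr _ _ _ fun i => ?_
  simp (disch := omega) only [rotRen_val, Fin.val_natAdd, Fin.val_castSucc, if_neg]
  omega

lemma SymRenPreoperad.mbind_var (P : SymRenPreoperad) {N m : ℕ} (f : P.C (N + m))
    (ρ : Fin m → Fin N) :
    P.mbind f (fun i => P.var (ρ i)) = P.ren f (Fin.addCases (fun i => i) ρ) := by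
  induction m with
  | zero =>
    rw [RenPreoperad.mbind]
    refine (P.ren_eq_self _ _ fun i => ?_).symm
    exact congrArg Fin.val (Fin.addCases_left (m := N) (n := 0) i)
  | succ m ih =>
    rw [RenPreoperad.mbind, ih, P.ren_var, P.bind_var, P.ren_ren]
    refine P.ren_congr _ _ _ fun i => ?_
    refine Fin.lastCases ?_ (fun j => ?_) i
    · simp [addCases_val]
      rfl
    · simp only [Fin.lastCases_castSucc, addCases_val, Fin.val_castSucc]
      rfl

lemma SymRenPreoperad.mapp_var (P : SymRenPreoperad) {n k : ℕ} (f : P.C k) (ρ : Fin k → Fin n) :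
    P.mapp f (fun i => P.var (ρ i)) = P.ren f ρ := by
  rw [RenPreoperad.mapp, P.mbind_var, P.ren_ren]
  exact P.ren_congr _ _ _ fun i => by simp

lemma RenPreoperadHom.map_mbind {P Q : RenPreoperad} (F : RenPreoperadHom P Q) {N m : ℕ}
    (f : P.C (N + m)) (a : Fin m → P.C N) :
    F.map (P.mbind f a) = Q.mbind (F.map f) fun i => F.map (a i) := by
  induction m with
  | zero => rfl
  | succ m ih =>
    rw [RenPreoperad.mbind, ih, F.map_bind, F.map_ren, RenPreoperad.mbind]

lemma RenPreoperadHom.map_mapp {P Q : RenPreoperad} (F : RenPreoperadHom P Q) {n k : ℕ}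
    (f : P.C k) (a : Fin k → P.C n) :
    F.map (P.mapp f a) = Q.mapp (F.map f) fun i => F.map (a i) := by
  rw [RenPreoperad.mapp, F.map_mbind, F.map_ren, RenPreoperad.mapp]

lemma WCFreydOperad.mapp_app_abs (O : WCFreydOperad) {n : ℕ} (f : O.C.C (n + 1)) (w : O.V.C n)
    (a : Fin 2 → O.C.C n) (h₀ : a 0 = O.I.map (O.abs f)) (h₁ : a 1 = O.I.map w) :
    O.C.mapp O.app a = O.C.bind f (O.I.map w) := by
  have h : O.C.mapp O.app a =
      O.C.bind (O.C.bind (O.C.ren O.app (Fin.natAdd n)) (O.C.ren (a 1) Fin.castSucc))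
        (O.C.ren (a 0) (Fin.castAdd 0)) := rfl
  rw [h, O.C.ren_eq_self (a 0) (Fin.castAdd 0) fun _ => rfl, h₀, h₁,
    (O.isValue_map _).bind_comm, ← O.I.map_ren]
  have e : O.C.ren (O.C.ren O.app (Fin.natAdd n)) (swapLast n) = O.C.ren O.app (appRen n) := by
    rw [O.C.ren_ren]
    refine O.C.ren_congr _ _ _ fun i => ?_
    have := i.isLt
    obtain hi | hi : i.val = 0 ∨ i.val = 1 := by omega
    all_goals simp [hi, appRen_val, swapLast_val]
  rw [e]
  exact congrArg (fun x => O.C.bind x (O.I.map w)) (O.eta_abs f)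

section Interpretation

variable {Sg : Sig} (S : CLCStructure Sg)

lemma interpV_func {n : ℕ} (f : Sg.Func) (args : Fin (Sg.fArity f) → DVal Sg n) :
    interpV S (.func f args) = S.O.V.mapp (S.Ff f) fun i => interpV S (args i) :=
  S.O.V.ren_psub _ _

lemma interpC_proc {n : ℕ} (p : Sg.Proc) (args : Fin (Sg.pArity p) → DVal Sg n) :
    interpC S (.proc p args) = S.O.C.mapp (S.Pp p) fun i => S.O.I.map (interpV S (args i)) :=
  S.O.C.ren_psub _ _

lemma interpC_app {n : ℕ} (V₁ V₂ : DVal Sg n) :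
    interpC S (.app V₁ V₂) = S.O.C.mapp S.O.app
      fun i => S.O.I.map (Fin.cases (interpV S V₁) (fun _ => interpV S V₂) i) :=
  S.O.C.ren_psub _ _

lemma interpC_letin {n : ℕ} (M₁ : DCmp Sg n) (M₂ : DCmp Sg (n + 1)) :
    interpC S (.letin M₁ M₂) = S.O.C.bind (interpC S M₂) (interpC S M₁) := rfl

lemma interpC_ret {n : ℕ} (W : DVal Sg n) : interpC S (.ret W) = S.O.I.map (interpV S W) := rfl

lemma interpV_lam {n : ℕ} (M : DCmp Sg (n + 1)) :
    interpV S (.lam M) = S.O.abs (interpC S M) := rfl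

lemma interpV_var {n : ℕ} (i : Fin n) :
    interpV S (.var i) = S.O.V.var i := rfl

mutual
/-- The interpretation of values commutes with renaming. -/
theorem interpV_renameV : ∀ {m n : ℕ} (V : DVal Sg m) (r : Fin m → Fin n),
    interpV S (renameV V r) = S.O.V.ren (interpV S V) r
  | _, _, .var i, r => by
    rw [renameV, interpV_var, interpV_var, S.O.V.ren_var]
  | _, _, .func f args, r => by
    rw [renameV, interpV_func, interpV_func, S.O.V.ren_mapp]
    congr 1
    funext i
    exact interpV_renameV (args i) r
  | _, _, .lam M, r => by
    rw [renameV, interpV_lam, interpV_lam, interpC_renameC M, S.O.abs_ren]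

/-- The interpretation of computations commutes with renaming. -/
theorem interpC_renameC : ∀ {m n : ℕ} (M : DCmp Sg m) (r : Fin m → Fin n),
    interpC S (renameC M r) = S.O.C.ren (interpC S M) r
  | _, _, .ret W, r => by
    rw [renameC, interpC_ret, interpC_ret, interpV_renameV W, S.O.I.map_ren]
  | _, _, .letin M₁ M₂, r => by
    rw [renameC, interpC_letin, interpC_letin, interpC_renameC M₁, interpC_renameC M₂,
      S.O.C.ren_bind]
  | _, _, .proc p args, r => by
    rw [renameC, interpC_proc, interpC_proc, S.O.C.ren_mapp]
    congr 1
    funext i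
    rw [interpV_renameV (args i) r, S.O.I.map_ren]
  | _, _, .app V₁ V₂, r => by
    rw [renameC, interpC_app, interpC_app, S.O.C.ren_mapp, interpV_renameV V₁,
      interpV_renameV V₂]
    congr 1
    funext i
    refine Fin.cases ?_ (fun j => ?_) i
    · exact S.O.I.map_ren _ _
    · exact S.O.I.map_ren _ _
end

lemma liftSub_sub1 {m n : ℕ} (W : DVal Sg n) (r : Fin m → Fin (n + 1)) :
    liftSub (fun i => sub1 W (r i)) =
      fun i => sub1 (renameV W Fin.castSucc) (swapLast n (liftRen r i)) := by
  funext i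
  refine Fin.lastCases ?_ (fun j => ?_) i
  · have h : swapLast n (liftRen r (Fin.last m)) = (Fin.last n).castSucc := by
      apply Fin.ext
      simp [swapLast_val, liftRen_val]
    rw [h]
    simp [liftSub, sub1]
  · obtain h | ⟨k, h⟩ := Fin.eq_castSucc_or_eq_last (r j) |>.symm
    · have h' : swapLast n (liftRen r j.castSucc) = Fin.last (n + 1) := by
        apply Fin.ext
        simp [swapLast_val, liftRen_val, h]
      rw [h']
      simp [liftSub, sub1, h]
    · have h' : swapLast n (liftRen r j.castSucc) = k.castSucc.castSucc := by
        apply Fin.ext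
        have := k.isLt
        simp only [swapLast_val, liftRen_val, h, Fin.val_castSucc, Fin.is_lt, dif_pos]
        split_ifs <;> omega
      rw [h']
      simp [liftSub, sub1, h, renameV]

mutual
/-- The interpretation sends value substitution in a value to `bind`. -/
theorem interpV_substV : ∀ {m n : ℕ} (V : DVal Sg m) (W : DVal Sg n) (r : Fin m → Fin (n + 1)),
    interpV S (substV V fun i => sub1 W (r i)) =
      S.O.V.bind (S.O.V.ren (interpV S V) r) (interpV S W)
  | _, n, .var i, W, r => by
    rw [substV, interpV_var, S.O.V.ren_var]
    refine Fin.lastCases ?_ (fun j => ?_) (r i)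
    · rw [S.O.V.bind_var_last]
      simp [sub1]
    · rw [← S.O.V.ren_var, S.O.V.bind_castSucc]
      simp [sub1, interpV_var]
  | _, _, .func f args, W, r => by
    rw [substV, interpV_func, interpV_func, S.O.V.ren_mapp, (S.O.V.isValue _).bind_mapp]
    congr 1
    funext i
    exact interpV_substV (args i) W r
  | _, _, .lam M, W, r => by
    rw [substV, interpV_lam, interpV_lam, liftSub_sub1, interpC_substC M, ← S.O.abs_ren,
      ← S.O.abs_bind, interpV_renameV, S.O.C.ren_ren]

/-- The interpretation sends value substitution in a computation to `bind`. -/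
theorem interpC_substC : ∀ {m n : ℕ} (M : DCmp Sg m) (W : DVal Sg n) (r : Fin m → Fin (n + 1)),
    interpC S (substC M fun i => sub1 W (r i)) =
      S.O.C.bind (S.O.C.ren (interpC S M) r) (S.O.I.map (interpV S W))
  | _, _, .ret V, W, r => by
    rw [substC, interpC_ret, interpC_ret, interpV_substV V, S.O.I.map_bind, S.O.I.map_ren]
  | _, _, .letin M₁ M₂, W, r => by
    rw [substC, interpC_letin, interpC_letin, liftSub_sub1, interpC_substC M₁,
      interpC_substC M₂, S.O.C.ren_bind, (S.O.isValue_map _).bind_bind_value, interpV_renameV,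
      S.O.C.ren_ren, S.O.I.map_ren]
  | _, _, .proc p args, W, r => by
    rw [substC, interpC_proc, interpC_proc, S.O.C.ren_mapp, (S.O.isValue_map _).bind_mapp]
    congr 1
    funext i
    rw [interpV_substV (args i) W r, S.O.I.map_bind, S.O.I.map_ren]
  | _, _, .app V₁ V₂, W, r => by
    rw [substC, interpC_app, interpC_app, S.O.C.ren_mapp, (S.O.isValue_map _).bind_mapp,
      interpV_substV V₁, interpV_substV V₂]
    congr 1
    funext i
    refine Fin.cases ?_ (fun j => ?_) i
    · simp only [Fin.cases_zero, S.O.I.map_bind, S.O.I.map_ren]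
    · simp only [Fin.cases_succ, S.O.I.map_bind, S.O.I.map_ren]
end

lemma interpC_substC_sub1 {n : ℕ} (M : DCmp Sg (n + 1)) (W : DVal Sg n) :
    interpC S (substC M (sub1 W)) = S.O.C.bind (interpC S M) (S.O.I.map (interpV S W)) :=
  (interpC_substC S M W fun i => i).trans (by rw [S.O.C.ren_eq_self _ _ fun _ => rfl])

mutual
/-- Soundness of the equational theory for values. -/
theorem EqV.interp_eq : ∀ {n : ℕ} {V V' : DVal Sg n}, EqV Sg V V' → interpV S V = interpV S V'
  | _, _, _, .refl _ => rfl
  | _, _, _, .symm h => (EqV.interp_eq h).symm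
  | _, _, _, .trans h h' => (EqV.interp_eq h).trans (EqV.interp_eq h')
  | _, _, _, .func f h => by
    rw [interpV_func, interpV_func]
    congr 1
    funext i
    exact EqV.interp_eq (h i)
  | _, _, _, .lam h => by
    rw [interpV_lam, interpV_lam, EqC.interp_eq h]

/-- Soundness of the equational theory for computations. -/
theorem EqC.interp_eq : ∀ {n : ℕ} {M M' : DCmp Sg n}, EqC Sg M M' → interpC S M = interpC S M'
  | _, _, _, .refl _ => rfl
  | _, _, _, .symm h => (EqC.interp_eq h).symm
  | _, _, _, .trans h h' => (EqC.interp_eq h).trans (EqC.interp_eq h')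
  | _, _, _, .ret h => by
    rw [interpC_ret, interpC_ret, EqV.interp_eq h]
  | _, _, _, .letin h h' => by
    rw [interpC_letin, interpC_letin, EqC.interp_eq h, EqC.interp_eq h']
  | _, _, _, .proc p h => by
    rw [interpC_proc, interpC_proc]
    congr 1
    funext i
    rw [EqV.interp_eq (h i)]
  | _, _, _, .app h h' => by
    rw [interpC_app, interpC_app, EqV.interp_eq h, EqV.interp_eq h']
  | _, _, _, .lunit W M => by
    rw [interpC_letin, interpC_ret, interpC_substC_sub1]
  | _, _, _, .runit M => by
    rw [interpC_letin, interpC_ret, interpV_var, S.O.I.map_var, S.O.C.bind_var_last]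
  | _, _, _, .assoc M₁ M₂ M => by
    rw [interpC_letin, interpC_letin, interpC_letin, interpC_letin, interpC_renameC,
      S.O.C.bind_bind]
  | _, _, _, .beta M W => by
    rw [interpC_substC_sub1, interpC_app]
    exact S.O.mapp_app_abs _ _ _ rfl rfl
end

end Interpretation

section Fusion

variable {Sg : Sig}

lemma liftRen_liftRen {m n k : ℕ} (r : Fin m → Fin n) (s : Fin n → Fin k) (i : Fin (m + 1)) :
    liftRen s (liftRen r i) = liftRen (fun j => s (r j)) i := by
  refine Fin.lastCases ?_ (fun j => ?_) i
  · simp [liftRen]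
  · simp [liftRen]

mutual
theorem renameV_renameV : ∀ {m n k : ℕ} (V : DVal Sg m) (r : Fin m → Fin n) (s : Fin n → Fin k),
    renameV (renameV V r) s = renameV V fun i => s (r i)
  | _, _, _, .var i, r, s => by simp only [renameV]
  | _, _, _, .func f args, r, s => by
    simp only [renameV]
    congr 1
    funext i
    exact renameV_renameV (args i) r s
  | _, _, _, .lam M, r, s => by
    simp only [renameV]
    rw [renameC_renameC M]
    congr 2
    funext i
    exact liftRen_liftRen r s i

theorem renameC_renameC : ∀ {m n k : ℕ} (M : DCmp Sg m) (r : Fin m → Fin n) (s : Fin n → Fin k),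
    renameC (renameC M r) s = renameC M fun i => s (r i)
  | _, _, _, .ret W, r, s => by
    simp only [renameC]
    rw [renameV_renameV W]
  | _, _, _, .letin M₁ M₂, r, s => by
    simp only [renameC]
    rw [renameC_renameC M₁, renameC_renameC M₂]
    congr 2
    funext i
    exact liftRen_liftRen r s i
  | _, _, _, .proc p args, r, s => by
    simp only [renameC]
    congr 1
    funext i
    exact renameV_renameV (args i) r s
  | _, _, _, .app V₁ V₂, r, s => by
    simp only [renameC]
    rw [renameV_renameV V₁, renameV_renameV V₂]
end

lemma liftSub_liftRen {m n k : ℕ} (r : Fin m → Fin n) (σ : Fin n → DVal Sg k) :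
    (fun i => liftSub σ (liftRen r i)) = liftSub fun j => σ (r j) := by
  funext i
  refine Fin.lastCases ?_ (fun j => ?_) i
  · simp [liftRen, liftSub]
  · simp [liftRen, liftSub]

lemma renameV_liftSub {m n k : ℕ} (σ : Fin m → DVal Sg n) (r : Fin n → Fin k) :
    (fun i => renameV (liftSub σ i) (liftRen r)) = liftSub fun j => renameV (σ j) r := by
  funext i
  refine Fin.lastCases ?_ (fun j => ?_) i
  · simp [liftRen, liftSub, renameV]
  · simp [liftRen, liftSub, renameV_renameV]

mutual
theorem substV_renameV : ∀ {m n k : ℕ} (V : DVal Sg m) (r : Fin m → Fin n)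
    (σ : Fin n → DVal Sg k), substV (renameV V r) σ = substV V fun i => σ (r i)
  | _, _, _, .var i, r, σ => by simp only [renameV, substV]
  | _, _, _, .func f args, r, σ => by
    simp only [renameV, substV]
    congr 1
    funext i
    exact substV_renameV (args i) r σ
  | _, _, _, .lam M, r, σ => by
    simp only [renameV, substV]
    rw [substC_renameC M, liftSub_liftRen]

theorem substC_renameC : ∀ {m n k : ℕ} (M : DCmp Sg m) (r : Fin m → Fin n)
    (σ : Fin n → DVal Sg k), substC (renameC M r) σ = substC M fun i => σ (r i)
  | _, _, _, .ret W, r, σ => by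
    simp only [renameC, substC]
    rw [substV_renameV W]
  | _, _, _, .letin M₁ M₂, r, σ => by
    simp only [renameC, substC]
    rw [substC_renameC M₁, substC_renameC M₂, liftSub_liftRen]
  | _, _, _, .proc p args, r, σ => by
    simp only [renameC, substC]
    congr 1
    funext i
    exact substV_renameV (args i) r σ
  | _, _, _, .app V₁ V₂, r, σ => by
    simp only [renameC, substC]
    rw [substV_renameV V₁, substV_renameV V₂]
end

mutual
theorem renameV_substV : ∀ {m n k : ℕ} (V : DVal Sg m) (σ : Fin m → DVal Sg n)
    (r : Fin n → Fin k), renameV (substV V σ) r = substV V fun i => renameV (σ i) r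
  | _, _, _, .var i, σ, r => by simp only [substV]
  | _, _, _, .func f args, σ, r => by
    simp only [renameV, substV]
    congr 1
    funext i
    exact renameV_substV (args i) σ r
  | _, _, _, .lam M, σ, r => by
    simp only [renameV, substV]
    rw [renameC_substC M, renameV_liftSub]

theorem renameC_substC : ∀ {m n k : ℕ} (M : DCmp Sg m) (σ : Fin m → DVal Sg n)
    (r : Fin n → Fin k), renameC (substC M σ) r = substC M fun i => renameV (σ i) r
  | _, _, _, .ret W, σ, r => by
    simp only [renameC, substC]
    rw [renameV_substV W]
  | _, _, _, .letin M₁ M₂, σ, r => by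
    simp only [renameC, substC]
    rw [renameC_substC M₁, renameC_substC M₂, renameV_liftSub]
  | _, _, _, .proc p args, σ, r => by
    simp only [renameC, substC]
    congr 1
    funext i
    exact renameV_substV (args i) σ r
  | _, _, _, .app V₁ V₂, σ, r => by
    simp only [renameC, substC]
    rw [renameV_substV V₁, renameV_substV V₂]
end

lemma midSubst_eq (n₁ n₂ : ℕ) {m : ℕ} (W : DVal Sg m) :
    midSubst n₁ n₂ W = fun i => sub1 (renameV W (embM n₁ m n₂)) (midToLast n₁ n₂ m i) := by
  funext i
  refine Fin.addCases (fun a => Fin.lastCases ?_ (fun b => ?_) a) (fun c => ?_) i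
  all_goals
    simp [midSubst, midToLast, sub1]

lemma renameV_sub1 {n k : ℕ} (W : DVal Sg n) (r : Fin n → Fin k) (i : Fin (n + 1)) :
    renameV (sub1 W i) r = sub1 (renameV W r) (liftRen r i) := by
  refine Fin.lastCases ?_ (fun j => ?_) i
  · simp [liftRen, sub1]
  · simp [liftRen, sub1, renameV]

lemma liftRen_copyRen_midToLast (n : ℕ) (i : Fin (n + 1)) :
    liftRen (copyRen n) (midToLast n 0 n i) = i := by
  apply Fin.ext
  have := i.isLt
  obtain hi | hi : i.val < n ∨ i.val = n := by omega
  all_goals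
    simp (disch := omega) only [liftRen_val, midToLast_val, copyRen_val, if_pos, if_neg, dif_pos,
      dif_neg]
  omega

end Fusion

lemma CartOperad.mbind_ren_castAdd (P : CartOperad) {N m : ℕ} (x : P.C N) (a : Fin m → P.C N) :
    P.mbind (P.ren x (Fin.castAdd m)) a = x := by
  induction m with
  | zero => exact P.ren_eq_self _ _ fun _ => rfl
  | succ m ih =>
    rw [RenPreoperad.mbind]
    have h : P.ren x (Fin.castAdd (m + 1)) = P.ren (P.ren x (Fin.castAdd m)) Fin.castSucc := by
      rw [P.ren_ren]
      exact P.ren_congr _ _ _ fun _ => rfl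
    rw [h, P.bind_castSucc, ih]

lemma CartOperad.mbind_var_natAdd (P : CartOperad) {N m : ℕ} (i : Fin m) (a : Fin m → P.C N) :
    P.mbind (P.var (Fin.natAdd N i)) a = a i := by
  induction m with
  | zero => exact i.elim0
  | succ m ih =>
    rw [RenPreoperad.mbind]
    refine Fin.lastCases ?_ (fun j => ?_) i
    · exact (congrArg (fun x => P.mbind x fun i => a i.castSucc) (P.bind_var_last _)).trans
        (P.mbind_ren_castAdd _ _)
    · have h : P.var (Fin.natAdd N j.castSucc) = P.ren (P.var (Fin.natAdd N j)) Fin.castSucc :=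
        (P.ren_var (Fin.natAdd N j) Fin.castSucc).symm
      rw [h, P.bind_castSucc, ih]

section TermModel

variable {Sg : Sig} {T : CLCStructure Sg} {eV : ∀ n : ℕ, T.O.V.C n ≃ Quot (@EqV Sg n)}
  {eC : ∀ n : ℕ, T.O.C.C n ≃ Quot (@EqC Sg n)}

/-- The class of a value in a term model. -/
def classV (eV : ∀ n : ℕ, T.O.V.C n ≃ Quot (@EqV Sg n)) {n : ℕ} (V : DVal Sg n) : T.O.V.C n :=
  (eV n).symm (Quot.mk _ V)

/-- The class of a computation in a term model. -/
def classC (eC : ∀ n : ℕ, T.O.C.C n ≃ Quot (@EqC Sg n)) {n : ℕ} (M : DCmp Sg n) : T.O.C.C n :=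
  (eC n).symm (Quot.mk _ M)

lemma exists_classV (eV : ∀ n : ℕ, T.O.V.C n ≃ Quot (@EqV Sg n)) {n : ℕ} (x : T.O.V.C n) :
    ∃ V, classV eV V = x := by
  obtain ⟨V, h⟩ := Quot.exists_rep (eV n x)
  exact ⟨V, by rw [classV, h, Equiv.symm_apply_apply]⟩

lemma exists_classC (eC : ∀ n : ℕ, T.O.C.C n ≃ Quot (@EqC Sg n)) {n : ℕ} (x : T.O.C.C n) :
    ∃ M, classC eC M = x := by
  obtain ⟨M, h⟩ := Quot.exists_rep (eC n x)
  exact ⟨M, by rw [classC, h, Equiv.symm_apply_apply]⟩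

lemma classV_sound {n : ℕ} {V V' : DVal Sg n} (h : EqV Sg V V') :
    classV eV V = classV eV V' := congrArg (eV n).symm (Quot.sound h)

lemma classC_sound {n : ℕ} {M M' : DCmp Sg n} (h : EqC Sg M M') :
    classC eC M = classC eC M' := congrArg (eC n).symm (Quot.sound h)

lemma eqV_of_classV_eq {n : ℕ} {V V' : DVal Sg n} (h : classV eV V = classV eV V') :
    EqV Sg V V' :=
  Equivalence.quot_mk_eq_iff ⟨.refl, .symm, .trans⟩ V V' |>.1 ((eV n).symm.injective h)

lemma eqC_of_classC_eq {n : ℕ} {M M' : DCmp Sg n} (h : classC eC M = classC eC M') :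
    EqC Sg M M' :=
  Equivalence.quot_mk_eq_iff ⟨.refl, .symm, .trans⟩ M M' |>.1 ((eC n).symm.injective h)

namespace IsTermModel

lemma substV_class (hT : IsTermModel T eV eC) {n₁ n₂ m : ℕ} (V₁ : DVal Sg (n₁ + 1 + n₂))
    (V₂ : DVal Sg m) :
    T.O.V.subst n₁ n₂ (classV eV V₁) (classV eV V₂) = classV eV (tsubV n₁ n₂ V₁ V₂) :=
  (Equiv.eq_symm_apply _).2 (hT.2.2.1 V₁ V₂)

lemma substC_class (hT : IsTermModel T eV eC) {n₁ n₂ m : ℕ} (M₁ : DCmp Sg (n₁ + 1 + n₂))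
    (M₂ : DCmp Sg m) :
    T.O.C.subst n₁ n₂ (classC eC M₁) (classC eC M₂) = classC eC (tletC n₁ n₂ M₁ M₂) :=
  (Equiv.eq_symm_apply _).2 (hT.2.2.2.1 M₁ M₂)

lemma renV_class (hT : IsTermModel T eV eC) {m n : ℕ} (V : DVal Sg m) (r : Ren m n) :
    T.O.V.ren (classV eV V) r = classV eV (renameV V r) :=
  (Equiv.eq_symm_apply _).2 (hT.2.2.2.2.1 V r)

lemma renC_class (hT : IsTermModel T eV eC) {m n : ℕ} (M : DCmp Sg m) (r : Ren m n) :
    T.O.C.ren (classC eC M) r = classC eC (renameC M r) :=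
  (Equiv.eq_symm_apply _).2 (hT.2.2.2.2.2.1 M r)

lemma ret_class (hT : IsTermModel T eV eC) {n : ℕ} (V : DVal Sg n) :
    T.O.I.map (classV eV V) = classC eC (.ret V) :=
  (Equiv.eq_symm_apply _).2 (hT.2.2.2.2.2.2.1 V)

lemma abs_class (hT : IsTermModel T eV eC) {n : ℕ} (M : DCmp Sg (n + 1)) :
    T.O.abs (classC eC M) = classV eV (.lam M) :=
  (Equiv.eq_symm_apply _).2 (hT.2.2.2.2.2.2.2.1 M)

lemma app_class (hT : IsTermModel T eV eC) : T.O.app = classC eC (.app (.var 0) (.var 1)) :=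
  (Equiv.eq_symm_apply _).2 hT.2.2.2.2.2.2.2.2.1

lemma func_class (hT : IsTermModel T eV eC) (f : Sg.Func) :
    T.Ff f = classV eV (.func f fun i => .var i) :=
  (Equiv.eq_symm_apply _).2 (hT.2.2.2.2.2.2.2.2.2.1 f)

lemma proc_class (hT : IsTermModel T eV eC) (p : Sg.Proc) :
    T.Pp p = classC eC (.proc p fun i => .var i) :=
  (Equiv.eq_symm_apply _).2 (hT.2.2.2.2.2.2.2.2.2.2 p)

lemma var_class (hT : IsTermModel T eV eC) {n : ℕ} (i : Fin n) :
    T.O.V.var i = classV eV (.var i) := by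
  have h : T.O.V.one = classV eV (.var 0) := (Equiv.eq_symm_apply _).2 hT.1
  rw [RenPreoperad.var, h, hT.renV_class, renameV]

lemma bindV_class (hT : IsTermModel T eV eC) {n : ℕ} (V : DVal Sg (n + 1)) (W : DVal Sg n) :
    T.O.V.bind (classV eV V) (classV eV W) =
      classV eV (substV V (sub1 (renameV (renameV W (embM n n 0)) (copyRen n)))) := by
  have h : T.O.V.subst n 0 (classV eV V) (classV eV W) = classV eV (tsubV n 0 V W) :=
    hT.substV_class (n₁ := n) (n₂ := 0) V W
  refine (congrArg (fun x => T.O.V.ren x (copyRen n)) h).trans ((hT.renV_class _ _).trans ?_)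
  rw [tsubV, midSubst_eq, renameV_substV]
  simp only [renameV_sub1]
  congr 2
  funext i
  exact congrArg _ (liftRen_copyRen_midToLast n i)

lemma letin_class (hT : IsTermModel T eV eC) {n : ℕ} (M : DCmp Sg n) (N : DCmp Sg (n + 1)) :
    T.O.C.bind (classC eC N) (classC eC M) = classC eC (.letin M N) := by
  have h : T.O.C.subst n 0 (classC eC N) (classC eC M) = classC eC (tletC n 0 N M) :=
    hT.substC_class (n₁ := n) (n₂ := 0) N M
  refine (congrArg (fun x => T.O.C.ren x (copyRen n)) h).trans ((hT.renC_class _ _).trans ?_)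
  refine classC_sound (EqC.letin (eqC_of_classC_eq (eC := eC) ?_)
    (eqC_of_classC_eq (eC := eC) ?_))
  · rw [← hT.renC_class, ← hT.renC_class, T.O.C.ren_ren]
    refine T.O.C.ren_eq_self _ _ fun i => ?_
    simp [embM, copyRen_val]
  · rw [← hT.renC_class, ← hT.renC_class, T.O.C.ren_ren]
    exact T.O.C.ren_eq_self _ _ fun i => congrArg Fin.val (liftRen_copyRen_midToLast n i)

lemma bindC_class (hT : IsTermModel T eV eC) {n : ℕ} (M : DCmp Sg (n + 1)) (W : DVal Sg n) :
    T.O.C.bind (classC eC M) (T.O.I.map (classV eV W)) =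
      classC eC (substC M (sub1 (renameV (renameV W (embM n n 0)) (copyRen n)))) := by
  have h : classV eV W = classV eV (renameV (renameV W (embM n n 0)) (copyRen n)) := by
    rw [← hT.renV_class, ← hT.renV_class, T.O.V.ren_ren]
    refine (T.O.V.ren_eq_self _ _ fun i => ?_).symm
    simp [embM, copyRen_val]
  rw [h, hT.ret_class, hT.letin_class]
  exact classC_sound (.lunit _ _)

end IsTermModel
end TermModel

/-- Substitution of a value for the last variable, matching `RenPreoperad.bind`. -/
def bindSub {Sg : Sig} {n : ℕ} (W : DVal Sg n) : Fin (n + 1) → DVal Sg n :=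
  sub1 (renameV (renameV W (embM n n 0)) (copyRen n))

/-- Iterated substitution of values for the last variables, matching `RenPreoperad.mbind`. -/
def multiSub {Sg : Sig} {N : ℕ} : ∀ {m : ℕ}, DVal Sg (N + m) → (Fin m → DVal Sg N) → DVal Sg N
  | 0, V, _ => V
  | m + 1, V, a =>
      multiSub (m := m) (substV V (bindSub (renameV (a (Fin.last m)) (Fin.castAdd m))))
        (fun i => a i.castSucc)

namespace IsTermModel

variable {Sg : Sig} {T : CLCStructure Sg} {eV : ∀ n : ℕ, T.O.V.C n ≃ Quot (@EqV Sg n)}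
  {eC : ∀ n : ℕ, T.O.C.C n ≃ Quot (@EqC Sg n)}

lemma mbind_class (hT : IsTermModel T eV eC) {N m : ℕ} (V : DVal Sg (N + m))
    (a : Fin m → DVal Sg N) :
    T.O.V.mbind (classV eV V) (fun i => classV eV (a i)) = classV eV (multiSub V a) := by
  induction m with
  | zero => rfl
  | succ m ih =>
    rw [RenPreoperad.mbind, hT.renV_class]
    exact (congrArg (fun x => T.O.V.mbind x fun i => classV eV (a i.castSucc))
      (hT.bindV_class (n := N + m) V _)).trans (ih _ _)

lemma mbind_func (hT : IsTermModel T eV eC) {N m : ℕ} (f : Sg.Func)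
    (b : Fin (Sg.fArity f) → DVal Sg (N + m))
    (a : Fin m → DVal Sg N) :
    T.O.V.mbind (classV eV (.func f b)) (fun i => classV eV (a i)) =
      classV eV (.func f fun j => multiSub (b j) a) := by
  induction m with
  | zero => rfl
  | succ m ih =>
    rw [RenPreoperad.mbind, hT.renV_class]
    exact (congrArg (fun x => T.O.V.mbind x fun i => classV eV (a i.castSucc))
      (hT.bindV_class (n := N + m) (.func f b) _)).trans (ih _ _)

lemma mbind_proc (hT : IsTermModel T eV eC) {N m : ℕ} (p : Sg.Proc)
    (b : Fin (Sg.pArity p) → DVal Sg (N + m))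
    (a : Fin m → DVal Sg N) :
    T.O.C.mbind (classC eC (.proc p b)) (fun i => T.O.I.map (classV eV (a i))) =
      classC eC (.proc p fun j => multiSub (b j) a) := by
  induction m with
  | zero => rfl
  | succ m ih =>
    rw [RenPreoperad.mbind, ← T.O.I.map_ren, hT.renV_class]
    exact (congrArg (fun x => T.O.C.mbind x fun i => T.O.I.map (classV eV (a i.castSucc)))
      (hT.bindC_class (n := N + m) (.proc p b) _)).trans (ih _ _)

lemma mbind_app (hT : IsTermModel T eV eC) {N m : ℕ} (V₁ V₂ : DVal Sg (N + m))
    (a : Fin m → DVal Sg N) :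
    T.O.C.mbind (classC eC (.app V₁ V₂)) (fun i => T.O.I.map (classV eV (a i))) =
      classC eC (.app (multiSub V₁ a) (multiSub V₂ a)) := by
  induction m with
  | zero => rfl
  | succ m ih =>
    rw [RenPreoperad.mbind, ← T.O.I.map_ren, hT.renV_class]
    exact (congrArg (fun x => T.O.C.mbind x fun i => T.O.I.map (classV eV (a i.castSucc)))
      (hT.bindC_class (n := N + m) (.app V₁ V₂) _)).trans (ih _ _ _)

lemma multiSub_var (hT : IsTermModel T eV eC) {n k : ℕ} (i : Fin k) (a : Fin k → DVal Sg n) :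
    EqV Sg (multiSub (.var (Fin.natAdd n i)) a) (a i) := by
  refine eqV_of_classV_eq (eV := eV) ?_
  rw [← hT.mbind_class, ← hT.var_class]
  exact T.O.V.mbind_var_natAdd i fun i => classV eV (a i)

lemma mapp_func (hT : IsTermModel T eV eC) {n : ℕ} (f : Sg.Func)
    (a : Fin (Sg.fArity f) → DVal Sg n) :
    T.O.V.mapp (T.Ff f) (fun i => classV eV (a i)) = classV eV (.func f a) := by
  rw [RenPreoperad.mapp, hT.func_class, hT.renV_class, renameV, hT.mbind_func]
  refine classV_sound (.func f fun i => ?_)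
  rw [renameV]
  exact hT.multiSub_var i a

lemma mapp_proc (hT : IsTermModel T eV eC) {n : ℕ} (p : Sg.Proc)
    (a : Fin (Sg.pArity p) → DVal Sg n) :
    T.O.C.mapp (T.Pp p) (fun i => T.O.I.map (classV eV (a i))) = classC eC (.proc p a) := by
  rw [RenPreoperad.mapp, hT.proc_class, hT.renC_class, renameC, hT.mbind_proc]
  refine classC_sound (.proc p fun i => ?_)
  rw [renameV]
  exact hT.multiSub_var i a

lemma mapp_app (hT : IsTermModel T eV eC) {n : ℕ} (a : Fin 2 → DVal Sg n) :
    T.O.C.mapp T.O.app (fun i => T.O.I.map (classV eV (a i))) =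
      classC eC (.app (a 0) (a 1)) := by
  rw [RenPreoperad.mapp, hT.app_class, hT.renC_class, renameC, hT.mbind_app]
  refine classC_sound (.app ?_ ?_) <;> rw [renameV]
  exacts [hT.multiSub_var 0 a, hT.multiSub_var 1 a]

variable {S : CLCStructure Sg}

mutual
/-- Every morphism out of a term model sends the class of a value to its interpretation. -/
theorem map_classV (hT : IsTermModel T eV eC) (ψ : CLCHom T S) :
    ∀ {n : ℕ} (V : DVal Sg n), ψ.mapV.map (classV eV V) = interpV S V
  | _, .var i => by
    rw [← hT.var_class, ψ.mapV.map_var, interpV_var]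
  | _, .func f a => by
    rw [← hT.mapp_func, ψ.mapV.map_mapp, ψ.mapFf, interpV_func]
    congr 1
    funext i
    exact map_classV hT ψ (a i)
  | _, .lam M => by
    rw [← hT.abs_class, ψ.mapAbs, map_classC hT ψ M, interpV_lam]

/-- Every morphism out of a term model sends the class of a computation to its interpretation. -/
theorem map_classC (hT : IsTermModel T eV eC) (ψ : CLCHom T S) :
    ∀ {n : ℕ} (M : DCmp Sg n), ψ.mapC.map (classC eC M) = interpC S M
  | _, .ret W => by
    rw [← hT.ret_class, ψ.squareI, map_classV hT ψ W, interpC_ret]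
  | _, .letin M₁ M₂ => by
    rw [← hT.letin_class, ψ.mapC.map_bind, map_classC hT ψ M₁, map_classC hT ψ M₂, interpC_letin]
  | _, .proc p a => by
    rw [← hT.mapp_proc, ψ.mapC.map_mapp, ψ.mapPp, interpC_proc]
    congr 1
    funext i
    rw [ψ.squareI, map_classV hT ψ (a i)]
  | _, .app V₁ V₂ => by
    have h := hT.mapp_app (Fin.cons V₁ fun _ => V₂)
    rw [Fin.cons_zero, Fin.cons_one] at h
    rw [← h, ψ.mapC.map_mapp, ψ.mapApp, interpC_app]
    congr 1
    funext i
    rw [ψ.squareI]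
    refine Fin.cases ?_ (fun j => ?_) i
    · exact congrArg S.O.I.map (map_classV hT ψ V₁)
    · exact congrArg S.O.I.map (map_classV hT ψ V₂)
end

end IsTermModel

section Interpretation

variable {Sg : Sig} {T : CLCStructure Sg}

/-- The interpretation of values, descended to the carrier of a term model. -/
def interpClassV (eV : ∀ n : ℕ, T.O.V.C n ≃ Quot (@EqV Sg n)) (S : CLCStructure Sg) {n : ℕ}
    (x : T.O.V.C n) : S.O.V.C n :=
  Quot.lift (interpV S) (fun _ _ h => EqV.interp_eq S h) (eV n x)

/-- The interpretation of computations, descended to the carrier of a term model. -/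
def interpClassC (eC : ∀ n : ℕ, T.O.C.C n ≃ Quot (@EqC Sg n)) (S : CLCStructure Sg) {n : ℕ}
    (x : T.O.C.C n) : S.O.C.C n :=
  Quot.lift (interpC S) (fun _ _ h => EqC.interp_eq S h) (eC n x)

variable {eV : ∀ n : ℕ, T.O.V.C n ≃ Quot (@EqV Sg n)}
  {eC : ∀ n : ℕ, T.O.C.C n ≃ Quot (@EqC Sg n)} {S : CLCStructure Sg}

lemma interpClassV_classV {n : ℕ} (V : DVal Sg n) :
    interpClassV eV S (classV eV V) = interpV S V := by
  rw [interpClassV, classV, Equiv.apply_symm_apply]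

lemma interpClassC_classC {n : ℕ} (M : DCmp Sg n) :
    interpClassC eC S (classC eC M) = interpC S M := by
  rw [interpClassC, classC, Equiv.apply_symm_apply]

lemma IsTermModel.one_class (hT : IsTermModel T eV eC) : T.O.V.one = classV eV (.var 0) :=
  (Equiv.eq_symm_apply _).2 hT.1

lemma RenPreoperad.var_zero (P : RenPreoperad) : P.var (0 : Fin 1) = P.one :=
  P.ren_eq_self _ _ fun i => by omega

/-- The interpretation of values as a cartesian preoperad functor. -/
def IsTermModel.interpHomV (hT : IsTermModel T eV eC) (S : CLCStructure Sg) :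
    RenPreoperadHom T.O.V.toRenPreoperad S.O.V.toRenPreoperad where
  map := interpClassV eV S
  map_one := by
    rw [hT.one_class, interpClassV_classV, interpV_var, S.O.V.var_zero]
  map_subst f g := by
    obtain ⟨V, rfl⟩ := exists_classV eV f
    obtain ⟨W, rfl⟩ := exists_classV eV g
    rw [hT.substV_class, interpClassV_classV, interpClassV_classV, interpClassV_classV, tsubV,
      midSubst_eq, interpV_substV, interpV_renameV, S.O.V.subst_eq_bind]
  map_ren f r := by
    obtain ⟨V, rfl⟩ := exists_classV eV f
    rw [hT.renV_class, interpClassV_classV, interpClassV_classV, interpV_renameV]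

/-- The interpretation of computations as a cartesian preoperad functor. -/
def IsTermModel.interpHomC (hT : IsTermModel T eV eC) (S : CLCStructure Sg) :
    RenPreoperadHom T.O.C.toRenPreoperad S.O.C.toRenPreoperad where
  map := interpClassC eC S
  map_one := by
    rw [← T.O.I.map_one, hT.one_class, hT.ret_class, interpClassC_classC, interpC_ret,
      interpV_var, S.O.I.map_var, S.O.C.var_zero]
  map_subst f g := by
    obtain ⟨M, rfl⟩ := exists_classC eC f
    obtain ⟨N, rfl⟩ := exists_classC eC g
    rw [hT.substC_class, interpClassC_classC, interpClassC_classC, interpClassC_classC, tletC,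
      interpC_letin, interpC_renameC, interpC_renameC, S.O.C.subst_eq_bind]
  map_ren f r := by
    obtain ⟨M, rfl⟩ := exists_classC eC f
    rw [hT.renC_class, interpClassC_classC, interpClassC_classC, interpC_renameC]

lemma IsTermModel.interpHomV_map (hT : IsTermModel T eV eC) {n : ℕ} (V : DVal Sg n) :
    (hT.interpHomV S).map (classV eV V) = interpV S V := interpClassV_classV V

lemma IsTermModel.interpHomC_map (hT : IsTermModel T eV eC) {n : ℕ} (M : DCmp Sg n) :
    (hT.interpHomC S).map (classC eC M) = interpC S M := interpClassC_classC M

/-- The interpretation as a morphism of structures out of a term model. -/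
def IsTermModel.interpHom (hT : IsTermModel T eV eC) (S : CLCStructure Sg) : CLCHom T S where
  mapV := hT.interpHomV S
  mapC := hT.interpHomC S
  squareI v := by
    obtain ⟨V, rfl⟩ := exists_classV eV v
    rw [hT.ret_class, hT.interpHomC_map, hT.interpHomV_map, interpC_ret]
  mapAbs f := by
    obtain ⟨M, rfl⟩ := exists_classC eC f
    rw [hT.abs_class, hT.interpHomV_map, hT.interpHomC_map, interpV_lam]
  mapApp := by
    rw [hT.app_class, hT.interpHomC_map, interpC_app]
    refine Eq.trans ?_ ((S.O.C.mapp_var S.O.app fun i => i).trans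
      (S.O.C.ren_eq_self _ _ fun _ => rfl))
    congr 1
    funext i
    rw [← S.O.I.map_var]
    refine Fin.cases rfl (fun j => ?_) i
    rw [Subsingleton.elim j 0]
    rfl
  mapFf f := by
    rw [hT.func_class, hT.interpHomV_map, interpV_func]
    exact (S.O.V.mapp_var _ fun i => i).trans (S.O.V.ren_eq_self _ _ fun _ => rfl)
  mapPp p := by
    rw [hT.proc_class, hT.interpHomC_map, interpC_proc]
    simp only [interpV_var, S.O.I.map_var]
    exact (S.O.C.mapp_var _ fun i => i).trans (S.O.C.ren_eq_self _ _ fun _ => rfl)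

lemma IsTermModel.hom_ext (hT : IsTermModel T eV eC) (φ ψ : CLCHom T S) : φ = ψ := by
  have hV : @RenPreoperadHom.map _ _ φ.mapV = @RenPreoperadHom.map _ _ ψ.mapV := by
    funext n x
    obtain ⟨V, rfl⟩ := exists_classV eV x
    rw [hT.map_classV, hT.map_classV]
  have hC : @RenPreoperadHom.map _ _ φ.mapC = @RenPreoperadHom.map _ _ ψ.mapC := by
    funext n x
    obtain ⟨M, rfl⟩ := exists_classC eC x
    rw [hT.map_classC, hT.map_classC]
  obtain ⟨⟨_, _, _, _⟩, ⟨_, _, _, _⟩⟩ := φ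
  obtain ⟨⟨_, _, _, _⟩, ⟨_, _, _, _⟩⟩ := ψ
  cases hV
  cases hC
  rfl

end Interpretation

/-- **initiality of the term model.** For every λ_CLC-structure `S` over
a fixed signature, the interpretation is the unique morphism of λ_CLC-structures from
the term model to `S`; hence the term model is initial in the category of
λ_CLC-structures. -/
theorem stmt18 {Sg : Sig} (T : CLCStructure Sg)
    (eV : ∀ n : ℕ, T.O.V.C n ≃ Quot (@EqV Sg n))
    (eC : ∀ n : ℕ, T.O.C.C n ≃ Quot (@EqC Sg n))
    (hT : IsTermModel T eV eC) (S : CLCStructure Sg) :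
    ∃ φ : CLCHom T S,
      (∀ {n : ℕ} (V : DVal Sg n), φ.mapV.map ((eV n).symm (Quot.mk _ V)) = interpV S V) ∧
      (∀ {n : ℕ} (M : DCmp Sg n), φ.mapC.map ((eC n).symm (Quot.mk _ M)) = interpC S M) ∧
      (∀ ψ : CLCHom T S, ψ = φ) :=
  ⟨hT.interpHom S, interpClassV_classV, interpClassC_classC, fun ψ => hT.hom_ext ψ _⟩
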